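/- If every d-dimensional bounded spindle P(u,v) with 2d − 1 facets incident to the vertex u and d facets incident to the vertex v admits a non-revisiting circuit walk from u to v of length at most d, then every d-dimensional Dantzig figure (P,u,v), bounded or unbounded, has circuit distance from u to v at most d. -/

import Mathlib

open scoped BigOperators

/-- Data defining a polyhedron `{z ∈ ℝ^d : A z ≥ b}` with rational data.
Under the `IsProper` assumption below it is full-dimensional with an
irredundant description, hence `d`-dimensional with exactly `f` facets. -/
structure PolyData (d f : ℕ) where
  A : Matrix (Fin f) (Fin d) ℚ
  b : Fin f → ℚ

namespace PolyData

variable {d f : ℕ}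

/-- The `i`-th row of `A` (outer normal of the `i`-th facet), as a real vector. -/
def row (P : PolyData d f) (i : Fin f) : Fin d → ℝ := fun j => (P.A i j : ℝ)

/-- The `i`-th right-hand side, as a real number. -/
def rhs (P : PolyData d f) (i : Fin f) : ℝ := (P.b i : ℝ)

/-- Value of the `i`-th linear form at `z`. -/
def eval (P : PolyData d f) (i : Fin f) (z : Fin d → ℝ) : ℝ := ∑ j, P.row i j * z j

/-- The feasible set `{z : A z ≥ b}`. -/
def toSet (P : PolyData d f) : Set (Fin d → ℝ) := {z | ∀ i, P.rhs i ≤ P.eval i z}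

/-- Indices of the constraints (facets) active (incident) at `z`. -/
def activeAt (P : PolyData d f) (z : Fin d → ℝ) : Set (Fin f) := {i | P.eval i z = P.rhs i}

/-- The `i`-th facet, as a subset of the polyhedron. -/
def facet (P : PolyData d f) (i : Fin f) : Set (Fin d → ℝ) :=
  {z ∈ P.toSet | P.eval i z = P.rhs i}

/-- The standing assumption: the polyhedron is full-dimensional and the
description is irredundant, i.e. every inequality is facet-defining. -/
def IsProper (P : PolyData d f) : Prop :=
  (∃ z, ∀ i, P.rhs i < P.eval i z) ∧
  ∀ i, ∃ z ∈ P.toSet, P.eval i z = P.rhs i ∧ ∀ i', i' ≠ i → P.rhs i' < P.eval i' z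

/-- A vertex: a feasible point whose active outer normals span `ℝ^d`. -/
def IsVertex (P : PolyData d f) (v : Fin d → ℝ) : Prop :=
  v ∈ P.toSet ∧ Submodule.span ℝ (P.row '' P.activeAt v) = ⊤

/-- A circuit direction of `P`: a nonzero `g` such that `A g` is
support-minimal in `{A x : x ≠ 0}` (taken here up to scaling). -/
def IsCircuit (P : PolyData d f) (g : Fin d → ℝ) : Prop :=
  g ≠ 0 ∧ ∀ x : Fin d → ℝ, x ≠ 0 →
    {i | P.eval i x ≠ 0} ⊆ {i | P.eval i g ≠ 0} →
    {i | P.eval i x ≠ 0} = {i | P.eval i g ≠ 0}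

/-- The set of circuits of `P`. -/
def circuits (P : PolyData d f) : Set (Fin d → ℝ) := {g | P.IsCircuit g}

/-- A (maximal) circuit walk `y 0, …, y k` of length `k`. -/
def IsCircuitWalk (P : PolyData d f) {k : ℕ} (y : Fin (k+1) → Fin d → ℝ) : Prop :=
  (∀ i, y i ∈ P.toSet) ∧
  ∀ i : Fin k, ∃ g ∈ P.circuits, ∃ α : ℝ, 0 < α ∧
    y i.succ = y i.castSucc + α • g ∧
    ∀ β : ℝ, α < β → y i.castSucc + β • g ∉ P.toSet

/-- The circuit distance from `u` to `v`: minimum length of a circuit walk. -/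
noncomputable def circuitDistance (P : PolyData d f) (u v : Fin d → ℝ) : ℕ∞ :=
  sInf {n : ℕ∞ | ∃ k : ℕ, n = (k : ℕ∞) ∧ ∃ y : Fin (k+1) → Fin d → ℝ,
    P.IsCircuitWalk y ∧ y 0 = u ∧ y (Fin.last k) = v}

/-- The circuit diameter: maximum circuit distance between two vertices. -/
noncomputable def circuitDiameter (P : PolyData d f) : ℕ∞ :=
  ⨆ (u : Fin d → ℝ) (v : Fin d → ℝ) (_ : P.IsVertex u) (_ : P.IsVertex v),
    P.circuitDistance u v

/-- `u` and `v` are joined by an edge of `P`. -/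
def IsEdge (P : PolyData d f) (u v : Fin d → ℝ) : Prop :=
  P.IsVertex u ∧ P.IsVertex v ∧ u ≠ v ∧
  segment ℝ u v = {z ∈ P.toSet | P.activeAt u ∩ P.activeAt v ⊆ P.activeAt z}

/-- An edge walk along vertices of `P`. -/
def IsEdgeWalk (P : PolyData d f) {k : ℕ} (y : Fin (k+1) → Fin d → ℝ) : Prop :=
  ∀ i : Fin k, P.IsEdge (y i.castSucc) (y i.succ)

/-- Combinatorial (edge) distance between two vertices. -/
noncomputable def edgeDistance (P : PolyData d f) (u v : Fin d → ℝ) : ℕ∞ :=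
  sInf {n : ℕ∞ | ∃ k : ℕ, n = (k : ℕ∞) ∧ ∃ y : Fin (k+1) → Fin d → ℝ,
    P.IsEdgeWalk y ∧ y 0 = u ∧ y (Fin.last k) = v}

/-- Combinatorial (edge) diameter. -/
noncomputable def edgeDiameter (P : PolyData d f) : ℕ∞ :=
  ⨆ (u : Fin d → ℝ) (v : Fin d → ℝ) (_ : P.IsVertex u) (_ : P.IsVertex v),
    P.edgeDistance u v

end PolyData

/-- `Δ_E(f,d)`: maximum combinatorial diameter of a `d`-dimensional
polyhedron with `f` facets. -/
noncomputable def maxEdgeDiameter (f d : ℕ) : ℕ∞ :=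
  ⨆ (P : PolyData d f) (_ : P.IsProper), P.edgeDiameter

/-- `Δ_C(f,d)`: maximum circuit diameter of a `d`-dimensional polyhedron
with `f` facets. -/
noncomputable def maxCircuitDiameter (f d : ℕ) : ℕ∞ :=
  ⨆ (P : PolyData d f) (_ : P.IsProper), P.circuitDiameter

/-- `Δ_C^u(f,d)`: maximum circuit diameter of an unbounded `d`-dimensional
polyhedron with `f` facets. -/
noncomputable def maxUnboundedCircuitDiameter (f d : ℕ) : ℕ∞ :=
  ⨆ (P : PolyData d f) (_ : P.IsProper ∧ ¬ Bornology.IsBounded P.toSet),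
    P.circuitDiameter

namespace PolyData

variable {d f : ℕ}

/-- A walk is simple if each step enters exactly one new facet. -/
def IsSimpleWalk (P : PolyData d f) {k : ℕ} (y : Fin (k+1) → Fin d → ℝ) : Prop :=
  ∀ i : Fin k, (P.activeAt (y i.succ) \ P.activeAt (y i.castSucc)).ncard = 1

/-- `P` is `C`-simple: all circuit walks of length at most `Δ_E(f,d)` are simple. -/
def IsCSimple (P : PolyData d f) : Prop :=
  ∀ k : ℕ, (k : ℕ∞) ≤ maxEdgeDiameter f d →
    ∀ y : Fin (k+1) → Fin d → ℝ, P.IsCircuitWalk y → P.IsSimpleWalk y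

/-- A non-revisiting walk: each step enters a facet containing no earlier
point of the walk. -/
def IsNonRevisiting (P : PolyData d f) {k : ℕ} (y : Fin (k+1) → Fin d → ℝ) : Prop :=
  ∀ i : Fin k, ∃ j : Fin f, j ∈ P.activeAt (y i.succ) ∧
    ∀ i' : Fin (k+1), i' ≤ i.castSucc → j ∉ P.activeAt (y i')

/-- `P` is a simple polyhedron: every vertex lies on exactly `d` facets. -/
def IsSimplePoly (P : PolyData d f) : Prop :=
  ∀ v, P.IsVertex v → (P.activeAt v).ncard = d

end PolyData

/-- Append a last coordinate: `(z, t) ∈ ℝ^{d+1}`. -/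
def snocVec {d : ℕ} (z : Fin d → ℝ) (t : ℝ) : Fin (d+1) → ℝ := Fin.snoc z t

namespace PolyData

variable {d f : ℕ}

/-- `W` is a wedge on `P` over the facet with index `i₀`:
`W = H^≤ ∩ (P × [0,∞))`, where the boundary hyperplane `H = {w : a·w = β}`
of the halfspace `H^≤` contains `P × {0}` on its feasible side, meets the
interior of `P × [0,∞)`, and meets `P × {0}` exactly in the facet `i₀`. -/
def IsWedgeOver (W : PolyData (d+1) (f+1)) (P : PolyData d f) (i₀ : Fin f) : Prop :=
  ∃ (a : Fin (d+1) → ℝ) (β : ℝ),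
    (∀ z ∈ P.toSet, ∑ j, a j * snocVec z 0 j ≤ β) ∧
    (∃ z, (∀ i, P.rhs i < P.eval i z) ∧ ∃ t : ℝ, 0 < t ∧ ∑ j, a j * snocVec z t j = β) ∧
    (∀ z ∈ P.toSet, (∑ j, a j * snocVec z 0 j = β ↔ z ∈ P.facet i₀)) ∧
    W.toSet = {w | ∑ j, a j * w j ≤ β} ∩
      {w | ∃ z ∈ P.toSet, ∃ t : ℝ, 0 ≤ t ∧ w = snocVec z t}

/-- `P` is wedge-simple: it is `C`-simple and over every facet there is a
`C`-simple wedge. -/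
def IsWedgeSimple (P : PolyData d f) : Prop :=
  P.IsCSimple ∧ ∀ i₀ : Fin f, ∃ W : PolyData (d+1) (f+1),
    W.IsProper ∧ W.IsWedgeOver P i₀ ∧ W.IsCSimple

end PolyData

/-- `k`-wedge-simplicity: `0`-wedge-simple means `C`-simple, and `P` is
`(k+1)`-wedge-simple if it is `C`-simple and over every facet there is a
`k`-wedge-simple wedge.  In particular `1`-wedge-simple = wedge-simple. -/
def IsKWedgeSimpleAux : ℕ → (d f : ℕ) → PolyData d f → Prop
  | 0, _, _, P => P.IsCSimple
  | (k+1), d, f, P => P.IsCSimple ∧ ∀ i₀ : Fin f,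
      ∃ W : PolyData (d+1) (f+1), W.IsProper ∧ W.IsWedgeOver P i₀ ∧
        IsKWedgeSimpleAux k (d+1) (f+1) W

def IsKWedgeSimple (k : ℕ) {d f : ℕ} (P : PolyData d f) : Prop :=
  IsKWedgeSimpleAux k d f P

namespace PolyData

variable {d : ℕ}

/-- `(P, u, v)` is a Dantzig figure: a `d`-dimensional polyhedron with `2d`
facets, `d` of which are incident to the vertex `u` and the other `d` to the
vertex `v`. -/
def IsDantzigFigure (P : PolyData d (2*d)) (u v : Fin d → ℝ) : Prop :=
  P.IsVertex u ∧ P.IsVertex v ∧ Disjoint (P.activeAt u) (P.activeAt v) ∧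
  P.activeAt u ∪ P.activeAt v = Set.univ ∧
  (P.activeAt u).ncard = d ∧ (P.activeAt v).ncard = d

end PolyData

/-- The (exposed) faces of a polyhedron, each obtained by turning a subset of
the inequalities into equations. -/
def PolyData.faces {d f : ℕ} (P : PolyData d f) : Set (Set (Fin d → ℝ)) :=
  {F | ∃ S : Set (Fin f), F = {z ∈ P.toSet | S ⊆ P.activeAt z}}

/-- Combinatorial equivalence: an inclusion-preserving bijection between the
face lattices. -/
def CombEquiv {d f d' f' : ℕ} (P : PolyData d f) (Q : PolyData d' f') : Prop :=
  ∃ φ : Set (Fin d → ℝ) → Set (Fin d' → ℝ),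
    Set.BijOn φ P.faces Q.faces ∧
    ∀ F ∈ P.faces, ∀ G ∈ P.faces, (F ⊆ G ↔ φ F ⊆ φ G)

/-- Two facets are adjacent if they share a ridge (a codimension-2 face). -/
def PolyData.AdjacentFacets {d f : ℕ} (P : PolyData d f) (i j : Fin f) : Prop :=
  i ≠ j ∧ Module.finrank ℝ (affineSpan ℝ (P.facet i ∩ P.facet j)).direction = d - 2

/-- The Klee–Walkup polyhedron `U_4`. -/
def U4 : PolyData 4 8 where
  A := !![-6,-3,0,1; -3,-6,1,0; -35,-45,6,3; -45,-35,3,6;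
          1,0,0,0; 0,1,0,0; 0,0,1,0; 0,0,0,1]
  b := ![-1,-1,-8,-8,0,0,0,0]

section

open Filter Topology

/-- `g` spans the line orthogonal to all vectors of `M` that are orthogonal to `g`. For a nonzero
`g` this says that `g` is a circuit direction of every pointed polyhedron whose set of facet
normals is `M`. -/
def IsCircuitOf {d : ℕ} (M : Set (Fin d → ℝ)) (g : Fin d → ℝ) : Prop :=
  ∀ x, (∀ p ∈ M, p ⬝ᵥ g = 0 → p ⬝ᵥ x = 0) → ∃ c : ℝ, x = c • g

namespace IsCircuitOf

variable {d : ℕ} {M M' : Set (Fin d → ℝ)} {g : Fin d → ℝ}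

theorem mono (h : IsCircuitOf M g) (hM : M ⊆ M') : IsCircuitOf M' g :=
  fun x hx => h x fun p hp => hx p (hM hp)

theorem smul (h : IsCircuitOf M g) {c : ℝ} (hc : c ≠ 0) : IsCircuitOf M (c • g) := by
  intro x hx
  obtain ⟨e, rfl⟩ := h x fun p hp h0 => hx p hp (by simp [h0])
  exact ⟨e / c, by rw [smul_smul, div_mul_cancel₀ _ hc]⟩

theorem of_union_neg (h : IsCircuitOf (M ∪ {p | -p ∈ M}) g) : IsCircuitOf M g := by
  intro x hx
  refine h x ?_
  rintro p (hp | hp) h0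
  · exact hx p hp h0
  · simpa using hx (-p) hp (by simpa using h0)

/-- Limits of circuits with respect to `M ∪ {x + δ y}`, as `δ → 0`, are circuits with respect to
`M` whenever `x, y ∈ M`. -/
theorem of_tendsto {ι : Type*} {l : Ultrafilter ι} (hM : M.Finite) {x y : Fin d → ℝ}
    (hx : x ∈ M) (hy : y ∈ M) {δ : ι → ℝ} (hδ : Tendsto δ l (𝓝 0))
    {G : ι → Fin d → ℝ} (hG : ∀ᶠ t in l, IsCircuitOf (insert (x + δ t • y) M) (G t))
    (hg : Tendsto G l (𝓝 g)) (hg0 : g ≠ 0) : IsCircuitOf M g := by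
  have hdot : ∀ p : Fin d → ℝ, Tendsto (fun t => p ⬝ᵥ G t) l (𝓝 (p ⬝ᵥ g)) := fun p =>
    ((continuous_const.dotProduct continuous_id).tendsto g).comp hg
  have hlim : ∀ p, (∀ᶠ t in l, p ⬝ᵥ G t = 0) → p ⬝ᵥ g = 0 := fun p hp =>
    tendsto_nhds_unique (hdot p) (tendsto_const_nhds.congr' (hp.mono fun t ht => ht.symm))
  have hT : ∀ᶠ t in l, ∀ p ∈ M, p ⬝ᵥ G t = 0 → ∀ᶠ s in l, p ⬝ᵥ G s = 0 := by
    refine (eventually_all_finite hM).2 fun p _ => ?_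
    by_cases h : ∀ᶠ s in l, p ⬝ᵥ G s = 0
    · exact Eventually.of_forall fun _ _ => h
    · exact (Ultrafilter.eventually_not.2 h).mono fun t ht h0 => absurd h0 ht
  have hxy : (∀ᶠ t in l, (x + δ t • y) ⬝ᵥ G t = 0) → x ⬝ᵥ g = 0 := by
    intro h
    have h1 : Tendsto (fun t => (x + δ t • y) ⬝ᵥ G t) l (𝓝 (x ⬝ᵥ g + 0 * (y ⬝ᵥ g))) := by
      simp only [add_dotProduct, smul_dotProduct, smul_eq_mul]
      exact (hdot x).add (hδ.mul (hdot y))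
    simpa using tendsto_nhds_unique h1
      (tendsto_const_nhds.congr' (h.mono fun t ht => ht.symm))
  -- vectors annihilated by everything that is eventually orthogonal to `G`
  have key : ∀ z, (∀ p ∈ M, (∀ᶠ s in l, p ⬝ᵥ G s = 0) → p ⬝ᵥ z = 0) →
      (∀ᶠ t in l, (x + δ t • y) ⬝ᵥ G t = 0 → (x + δ t • y) ⬝ᵥ z = 0) →
      ∀ᶠ t in l, ∃ c : ℝ, z = c • G t := by
    intro z hz hz'
    filter_upwards [hT, hG, hz'] with t h1 h2 h3
    refine h2 z fun p hp h0 => ?_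
    rcases hp with rfl | hp
    · exact h3 h0
    · exact hz p hp (h1 p hp h0)
  have hgT : ∀ p ∈ M, (∀ᶠ s in l, p ⬝ᵥ G s = 0) → p ⬝ᵥ g = 0 := fun p _ => hlim p
  have prop : ∀ z, (∀ᶠ t in l, ∃ c : ℝ, z = c • G t) → (∀ᶠ t in l, ∃ c : ℝ, g = c • G t) →
      ∃ c : ℝ, z = c • g := by
    intro z h1 h2
    obtain ⟨t, ⟨c, hc⟩, e, he⟩ := (h1.and h2).exists
    have he0 : e ≠ 0 := by rintro rfl; exact hg0 (by simpa using he)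
    exact ⟨c / e, by rw [he, hc, smul_smul, div_mul_cancel₀ _ he0]⟩
  intro z hz
  have hzT : ∀ p ∈ M, (∀ᶠ s in l, p ⬝ᵥ G s = 0) → p ⬝ᵥ z = 0 := fun p hp h =>
    hz p hp (hlim p h)
  by_cases hs : ∀ᶠ t in l, (x + δ t • y) ⬝ᵥ G t = 0
  · have hxg := hxy hs
    have hxz := hz x hx hxg
    by_cases hyg : y ⬝ᵥ g = 0
    · have hyz := hz y hy hyg
      exact prop z (key z hzT (by simp [hxz, hyz])) (key g hgT (by simp [hxg, hyg]))
    · set w := z - ((y ⬝ᵥ z) / (y ⬝ᵥ g)) • g with hw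
      have hyw : y ⬝ᵥ w = 0 := by
        simp only [hw, dotProduct_sub, dotProduct_smul, smul_eq_mul]; field_simp; ring
      have hxw : x ⬝ᵥ w = 0 := by simp [hw, dotProduct_sub, hxg, hxz]
      have hwT : ∀ p ∈ M, (∀ᶠ s in l, p ⬝ᵥ G s = 0) → p ⬝ᵥ w = 0 := fun p hp h => by
        simp [hw, dotProduct_sub, hzT p hp h, hgT p hp h]
      have hyG : ∀ᶠ t in l, y ⬝ᵥ G t ≠ 0 := (hdot y).eventually_ne hyg
      obtain ⟨t, ⟨c, hc⟩, h1⟩ := ((key w hwT (by simp [hxw, hyw])).and hyG).exists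
      have hc0 : c = 0 := by
        have := hyw
        rw [hc, dotProduct_smul, smul_eq_mul] at this
        exact (mul_eq_zero.1 this).resolve_right h1
      refine ⟨(y ⬝ᵥ z) / (y ⬝ᵥ g), ?_⟩
      rw [hc0, zero_smul, hw] at hc
      exact sub_eq_zero.1 hc
  · have hs' := Ultrafilter.eventually_not.2 hs
    exact prop z (key z hzT (hs'.mono fun t h1 h2 => absurd h2 h1))
      (key g hgT (hs'.mono fun t h1 h2 => absurd h2 h1))

theorem of_tendsto_self {ι : Type*} {l : Ultrafilter ι} (hM : M.Finite) {x : Fin d → ℝ}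
    (hx : x ∈ M) {G : ι → Fin d → ℝ} (hG : ∀ᶠ t in l, IsCircuitOf M (G t))
    (hg : Tendsto G l (𝓝 g)) (hg0 : g ≠ 0) : IsCircuitOf M g :=
  of_tendsto hM hx hx (tendsto_const_nhds (x := (0 : ℝ)))
    (hG.mono fun _ ht => ht.mono (Set.subset_insert _ _)) hg hg0

/-- Non-orthogonality to a fixed vector passes to nonzero limits of circuits. -/
theorem dotProduct_ne_zero_of_tendsto {ι : Type*} {l : Ultrafilter ι} (hM : M.Finite)
    {G : ι → Fin d → ℝ} (hG : ∀ᶠ t in l, IsCircuitOf M (G t)) (hg : Tendsto G l (𝓝 g))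
    (hg0 : g ≠ 0) {q : Fin d → ℝ} (hq : ∀ᶠ t in l, q ⬝ᵥ G t ≠ 0) : q ⬝ᵥ g ≠ 0 := by
  have hlim : ∀ p, (∀ᶠ t in l, p ⬝ᵥ G t = 0) → p ⬝ᵥ g = 0 := fun p hp =>
    tendsto_nhds_unique (((continuous_const.dotProduct continuous_id).tendsto g).comp hg)
      (tendsto_const_nhds.congr' (hp.mono fun t ht => ht.symm))
  have hT : ∀ᶠ t in l, ∀ p ∈ M, p ⬝ᵥ G t = 0 → ∀ᶠ s in l, p ⬝ᵥ G s = 0 := by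
    refine (eventually_all_finite hM).2 fun p _ => ?_
    by_cases h : ∀ᶠ s in l, p ⬝ᵥ G s = 0
    · exact Eventually.of_forall fun _ _ => h
    · exact (Ultrafilter.eventually_not.2 h).mono fun t ht h0 => absurd h0 ht
  obtain ⟨t, h1, h2, h3⟩ := (hT.and (hG.and hq)).exists
  obtain ⟨c, rfl⟩ := h2 g fun p hp h0 => hlim p (h1 p hp h0)
  have hc : c ≠ 0 := by rintro rfl; simp at hg0
  simpa [hc] using h3

end IsCircuitOf

namespace PolyData

variable {d f : ℕ} {P : PolyData d f}

theorem eval_eq_dotProduct (P : PolyData d f) (i : Fin f) (z : Fin d → ℝ) :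
    P.eval i z = P.row i ⬝ᵥ z := rfl

theorem isCircuit_of_isCircuitOf {g : Fin d → ℝ} (hg : g ≠ 0)
    (h : IsCircuitOf (Set.range P.row) g) : P.IsCircuit g := by
  refine ⟨hg, fun x hx hsub => ?_⟩
  obtain ⟨c, rfl⟩ := h x (by
    rintro _ ⟨i, rfl⟩ h0
    by_contra h1
    exact hsub (a := i) h1 h0)
  have hc : c ≠ 0 := by rintro rfl; simp at hx
  ext i
  simp [eval_eq_dotProduct, hc]

theorem IsCircuit.isCircuitOf {g : Fin d → ℝ} (h : P.IsCircuit g)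
    (hP : ∀ x, (∀ i, P.row i ⬝ᵥ x = 0) → x = 0) : IsCircuitOf (Set.range P.row) g := by
  intro x hx
  obtain ⟨i, hi⟩ : ∃ i, P.row i ⬝ᵥ g ≠ 0 := by
    by_contra! hcon
    exact h.1 (hP g hcon)
  set c := (P.row i ⬝ᵥ x) / (P.row i ⬝ᵥ g)
  refine ⟨c, ?_⟩
  by_contra hne
  have heq := h.2 (x - c • g) (sub_ne_zero.2 hne) (by
    intro k hk hk0
    rw [eval_eq_dotProduct] at hk0
    exact hk (by simp [eval_eq_dotProduct, dotProduct_sub, hk0, hx _ ⟨k, rfl⟩ hk0]))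
  have : i ∈ {k | P.eval k g ≠ 0} := hi
  rw [← heq] at this
  refine this ?_
  simp only [eval_eq_dotProduct, dotProduct_sub, dotProduct_smul, smul_eq_mul, c]
  field_simp
  ring

end PolyData

/-- Walks of length at most `n` from `u` to a point where all constraints `a k ⬝ᵥ x ≥ β k` with
`k ∈ J` are tight, inside `{x : a x ≥ β}` and the ball of radius `R`. Every step goes in a unit
direction `g` and ends on some new facet `j ∈ J` such that `D g j` holds; steps of length zero are
allowed. -/
def HasWalk {d f : ℕ} (a : Fin f → Fin d → ℝ) (J : Set (Fin f)) (u : Fin d → ℝ) (R : ℝ) (n : ℕ)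
    (D : (Fin d → ℝ) → Fin f → Prop) (β : Fin f → ℝ) : Prop :=
  ∃ m ≤ n, ∃ (j : Fin m → Fin f) (y : ℕ → Fin d → ℝ) (g : Fin m → Fin d → ℝ) (α : Fin m → ℝ),
    y 0 = u ∧ (∀ k ∈ J, a k ⬝ᵥ y m = β k) ∧
    (∀ i ≤ m, ‖y i‖ ≤ R ∧ ∀ k, β k ≤ a k ⬝ᵥ y i) ∧
    (∀ i : Fin m, j i ∈ J ∧ ‖g i‖ = 1 ∧ D (g i) (j i) ∧ 0 ≤ α i ∧
      y (i + 1) = y i + α i • g i ∧ a (j i) ⬝ᵥ y (i + 1) = β (j i)) ∧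
    Function.Injective j

namespace HasWalk

variable {d f : ℕ} {a : Fin f → Fin d → ℝ} {J : Set (Fin f)} {u : Fin d → ℝ} {R : ℝ} {n : ℕ}
  {D : (Fin d → ℝ) → Fin f → Prop} {β : Fin f → ℝ}

theorem mono (h : HasWalk a J u R n D β) {D' : (Fin d → ℝ) → Fin f → Prop}
    (hD : ∀ g k, D g k → D' g k) : HasWalk a J u R n D' β := by
  obtain ⟨m, hm, j, y, g, α, h0, h1, h2, h3, h4⟩ := h
  exact ⟨m, hm, j, y, g, α, h0, h1, h2,
    fun i => ⟨(h3 i).1, (h3 i).2.1, hD _ _ (h3 i).2.2.1, (h3 i).2.2.2⟩, h4⟩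

theorem of_tendsto {ι : Type*} {l : Ultrafilter ι} {D' : ι → (Fin d → ℝ) → Fin f → Prop}
    {β' : ι → Fin f → ℝ} (hβ : Tendsto β' l (𝓝 β))
    (hD : ∀ (G : ι → Fin d → ℝ) (g : Fin d → ℝ) (k : Fin f), (∀ᶠ t in l, D' t (G t) k) →
      Tendsto G l (𝓝 g) → ‖g‖ = 1 → D g k)
    (h : ∀ᶠ t in l, HasWalk a J u R n (D' t) (β' t)) : HasWalk a J u R n D β := by
  obtain ⟨m, hm, h⟩ := (Ultrafilter.eventually_exists_mem_iff (Set.finite_Iic n)).1 h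
  obtain ⟨j, h⟩ := Ultrafilter.eventually_exists_iff.1 h
  obtain ⟨w, hw⟩ : ∃ w : ι → (ℕ → Fin d → ℝ) × (Fin m → Fin d → ℝ) × (Fin m → ℝ), _ :=
    Eventually.choice (h.mono fun t ⟨y, g, α, hh⟩ => (⟨(y, g, α), hh⟩ : ∃ w : (ℕ → Fin d → ℝ) ×
      (Fin m → Fin d → ℝ) × (Fin m → ℝ), w.1 0 = u ∧ (∀ k ∈ J, a k ⬝ᵥ w.1 m = β' t k) ∧
      (∀ i ≤ m, ‖w.1 i‖ ≤ R ∧ ∀ k, β' t k ≤ a k ⬝ᵥ w.1 i) ∧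
      (∀ i : Fin m, j i ∈ J ∧ ‖w.2.1 i‖ = 1 ∧ D' t (w.2.1 i) (j i) ∧ 0 ≤ w.2.2 i ∧
        w.1 (i + 1) = w.1 i + w.2.2 i • w.2.1 i ∧ a (j i) ⬝ᵥ w.1 (i + 1) = β' t (j i)) ∧
      Function.Injective j))
  have hβk : ∀ k, Tendsto (fun t => β' t k) l (𝓝 (β k)) := fun k => tendsto_pi_nhds.1 hβ k
  have hy : ∀ i, ∃ x, i ≤ m → Tendsto (fun t => (w t).1 i) l (𝓝 x) := by
    intro i
    by_cases hi : i ≤ m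
    · obtain ⟨x, -, hx⟩ := (isCompact_closedBall (0 : Fin d → ℝ) R).ultrafilter_le_nhds'
        (l.map fun t => (w t).1 i) (hw.mono fun t ht => by simpa using (ht.2.2.1 i hi).1)
      exact ⟨x, fun _ => hx⟩
    · exact ⟨0, fun h => absurd h hi⟩
  have hg : ∀ i, ∃ x, ‖x‖ = 1 ∧ Tendsto (fun t => (w t).2.1 i) l (𝓝 x) := by
    intro i
    obtain ⟨x, hx1, hx⟩ := (isCompact_sphere (0 : Fin d → ℝ) 1).ultrafilter_le_nhds'
      (l.map fun t => (w t).2.1 i) (hw.mono fun t ht => by simpa using (ht.2.2.2.1 i).2.1)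
    exact ⟨x, by simpa using hx1, hx⟩
  have hα : ∀ i, ∃ x, 0 ≤ x ∧ Tendsto (fun t => (w t).2.2 i) l (𝓝 x) := by
    intro i
    obtain ⟨x, hx1, hx⟩ := (isCompact_Icc (a := (0 : ℝ)) (b := R + R)).ultrafilter_le_nhds'
      (l.map fun t => (w t).2.2 i) (hw.mono fun t ht => by
        obtain ⟨-, h1, -, h2, h3, -⟩ := ht.2.2.2.1 i
        refine ⟨h2, ?_⟩
        have h4 : (w t).2.2 i • (w t).2.1 i = (w t).1 (i + 1) - (w t).1 i := by rw [h3]; abel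
        have h5 : ‖(w t).2.2 i • (w t).2.1 i‖ = (w t).2.2 i := by
          rw [norm_smul, h1, mul_one, Real.norm_of_nonneg h2]
        change (w t).2.2 i ≤ R + R
        rw [← h5, h4]
        exact (norm_sub_le _ _).trans (add_le_add (ht.2.2.1 _ i.2).1 (ht.2.2.1 _ i.2.le).1))
    exact ⟨x, hx1.1, hx⟩
  choose y hy using hy
  choose g hg1 hg using hg
  choose α hα0 hα using hα
  have hdot : ∀ k, ∀ i ≤ m, Tendsto (fun t => a k ⬝ᵥ (w t).1 i) l (𝓝 (a k ⬝ᵥ y i)) :=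
    fun k i hi => ((continuous_const.dotProduct continuous_id).tendsto _).comp (hy i hi)
  refine ⟨m, hm, j, y, g, α, ?_, ?_, ?_, ?_, ?_⟩
  · exact tendsto_nhds_unique (hy 0 (Nat.zero_le _))
      (tendsto_const_nhds.congr' (hw.mono fun t ht => ht.1.symm))
  · exact fun k hk => tendsto_nhds_unique (hdot k m le_rfl)
      ((hβk k).congr' (hw.mono fun t ht => (ht.2.1 k hk).symm))
  · refine fun i hi => ⟨le_of_tendsto (hy i hi).norm (hw.mono fun t ht => (ht.2.2.1 i hi).1),
      fun k => le_of_tendsto_of_tendsto (hβk k) (hdot k i hi)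
        (hw.mono fun t ht => (ht.2.2.1 i hi).2 k)⟩
  · intro i
    obtain ⟨t, ht⟩ := hw.exists
    refine ⟨(ht.2.2.2.1 i).1, hg1 i, hD _ _ _ (hw.mono fun t ht => (ht.2.2.2.1 i).2.2.1) (hg i)
      (hg1 i), hα0 i, ?_, ?_⟩
    · exact tendsto_nhds_unique (hy _ i.2) (((hy _ i.2.le).add ((hα i).smul (hg i))).congr'
        (hw.mono fun t ht => (ht.2.2.2.1 i).2.2.2.2.1.symm))
    · exact tendsto_nhds_unique (hdot _ _ i.2)
        ((hβk _).congr' (hw.mono fun t ht => (ht.2.2.2.1 i).2.2.2.2.2.symm))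
  · obtain ⟨t, ht⟩ := hw.exists
    exact ht.2.2.2.2

end HasWalk

/-- The vector `x` has rational coordinates. -/
def IsRatVec {d : ℕ} (x : Fin d → ℝ) : Prop := ∃ q : Fin d → ℚ, x = fun i => (q i : ℝ)

theorem IsRatVec.add_smul {d : ℕ} {x y : Fin d → ℝ} (hx : IsRatVec x) (hy : IsRatVec y) (c : ℚ) :
    IsRatVec (x + (c : ℝ) • y) := by
  obtain ⟨q, rfl⟩ := hx
  obtain ⟨r, rfl⟩ := hy
  exact ⟨fun i => q i + c * r i, by ext i; simp⟩

theorem exists_rat_pos_of_eventually {p : ℝ → Prop} (h : ∀ᶠ δ in 𝓝 (0 : ℝ), 0 < δ → p δ) :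
    ∃ δ : ℚ, 0 < (δ : ℝ) ∧ p δ := by
  obtain ⟨ε, hε, h⟩ := Metric.eventually_nhds_iff.1 h
  obtain ⟨δ, h0, h1⟩ := exists_rat_btwn hε
  exact ⟨δ, h0, h (by rw [Real.dist_eq, sub_zero, abs_of_pos h0]; exact h1) h0⟩

/-- A finite system of rational linear inequalities `m ⬝ᵥ x ≥ 0` satisfied strictly by `v`, all of
which define facets, two of which are simultaneously tight at some nonzero point of the cone. -/
structure IsFacetSystem {d : ℕ} (K : Finset (Fin d → ℝ)) (v : Fin d → ℝ) : Prop where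
  rat : ∀ m ∈ K, IsRatVec m
  pos : ∀ m ∈ K, 0 < m ⬝ᵥ v
  facet : ∀ m ∈ K, ∃ z, m ⬝ᵥ z = 0 ∧ ∀ m' ∈ K, m' ≠ m → 0 < m' ⬝ᵥ z
  ridge : ∃ m₁ ∈ K, ∃ m₂ ∈ K, ∃ m₃ ∈ K, m₁ ≠ m₂ ∧ ∃ z, m₁ ⬝ᵥ z = 0 ∧ m₂ ⬝ᵥ z = 0 ∧
    0 < m₃ ⬝ᵥ z ∧ ∀ m ∈ K, 0 ≤ m ⬝ᵥ z

namespace IsFacetSystem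

variable {d : ℕ} {K : Finset (Fin d → ℝ)} {v : Fin d → ℝ}

open Classical in
/-- One more facet can be cut off, using a vector close to those already present. -/
theorem exists_insert (h : IsFacetSystem K v) {B : Set (Fin d → ℝ) → Prop}
    (hB : ∀ M, B M → ∀ x ∈ M, ∀ y ∈ M, ∀ᶠ δ in 𝓝 (0 : ℝ), B (insert (x + δ • y) M))
    {M : Set (Fin d → ℝ)} (hM : B M) (hK : ↑K ⊆ M) :
    ∃ n ∉ K, IsFacetSystem (insert n K) v ∧ ∃ M', B M' ∧ ↑(insert n K) ⊆ M' := by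
  obtain ⟨m₁, h₁, m₂, h₂, m₃, h₃, h₁₂, z₀, hz₁, hz₂, hz₃, hz⟩ := h.ridge
  obtain ⟨z₁, hz₁₁, hz₁'⟩ := h.facet m₁ h₁
  have h₂₁ := hz₁' m₂ h₂ h₁₂.symm
  -- the vector `q` changes sign on the facet of `m₁`
  obtain ⟨η, hη, hη₁, hη₂⟩ : ∃ η : ℚ, 0 < (η : ℝ) ∧ 0 < m₂ ⬝ᵥ z₁ + (-η : ℝ) * (m₃ ⬝ᵥ z₁) ∧
      B (insert (m₂ + (-η : ℝ) • m₃) M) := by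
    apply exists_rat_pos_of_eventually
      (p := fun η => 0 < m₂ ⬝ᵥ z₁ + (-η : ℝ) * (m₃ ⬝ᵥ z₁) ∧ B (insert (m₂ + (-η : ℝ) • m₃) M))
    have e₁ : ∀ᶠ η in 𝓝 (0 : ℝ), 0 < m₂ ⬝ᵥ z₁ + (-η) * (m₃ ⬝ᵥ z₁) := by
      have : Continuous fun η : ℝ => m₂ ⬝ᵥ z₁ + (-η) * (m₃ ⬝ᵥ z₁) := by fun_prop
      exact this.continuousAt.eventually (lt_mem_nhds (by simpa using h₂₁))
    have e₂ : ∀ᶠ η in 𝓝 (0 : ℝ), B (insert (m₂ + (-η) • m₃) M) := by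
      have : Tendsto (fun η : ℝ => -η) (𝓝 0) (𝓝 0) := by
        simpa using (continuous_neg (G := ℝ)).tendsto 0
      exact this.eventually (hB M hM m₂ (hK h₂) m₃ (hK h₃))
    filter_upwards [e₁, e₂] with η a b _ using ⟨a, b⟩
  set q := m₂ + (-η : ℝ) • m₃ with hq
  set M₁ := insert q M
  have hqz₁ : 0 < q ⬝ᵥ z₁ := by simpa only [hq, add_dotProduct, smul_dotProduct, smul_eq_mul]
  have hqz₀ : q ⬝ᵥ z₀ < 0 := by
    simp only [hq, add_dotProduct, smul_dotProduct, smul_eq_mul, hz₂]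
    nlinarith
  obtain ⟨δ, hδ, hδv, hδK, hδB⟩ : ∃ δ : ℚ, 0 < (δ : ℝ) ∧ 0 < m₁ ⬝ᵥ v + (δ : ℝ) * (q ⬝ᵥ v) ∧
      (∀ m ∈ K, m ≠ m₁ → ∃ z, m ⬝ᵥ z = 0 ∧ (∀ m' ∈ K, m' ≠ m → 0 < m' ⬝ᵥ z) ∧
        0 < m₁ ⬝ᵥ z + (δ : ℝ) * (q ⬝ᵥ z)) ∧ B (insert (m₁ + (δ : ℝ) • q) M₁) := by
    apply exists_rat_pos_of_eventually (p := fun δ => 0 < m₁ ⬝ᵥ v + δ * (q ⬝ᵥ v) ∧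
      (∀ m ∈ K, m ≠ m₁ → ∃ z, m ⬝ᵥ z = 0 ∧ (∀ m' ∈ K, m' ≠ m → 0 < m' ⬝ᵥ z) ∧
        0 < m₁ ⬝ᵥ z + δ * (q ⬝ᵥ z)) ∧ B (insert (m₁ + δ • q) M₁))
    have e : ∀ z, 0 < m₁ ⬝ᵥ z → ∀ᶠ δ in 𝓝 (0 : ℝ), 0 < m₁ ⬝ᵥ z + δ * (q ⬝ᵥ z) := by
      intro z hz
      have : Continuous fun δ : ℝ => m₁ ⬝ᵥ z + δ * (q ⬝ᵥ z) := by fun_prop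
      exact this.continuousAt.eventually (lt_mem_nhds (by simpa using hz))
    have e₁ : ∀ᶠ δ in 𝓝 (0 : ℝ), ∀ m ∈ K, m ≠ m₁ → ∃ z, m ⬝ᵥ z = 0 ∧
        (∀ m' ∈ K, m' ≠ m → 0 < m' ⬝ᵥ z) ∧ 0 < m₁ ⬝ᵥ z + δ * (q ⬝ᵥ z) := by
      refine (eventually_all_finset K).2 fun m hm => ?_
      by_cases hmm : m = m₁
      · exact Eventually.of_forall fun _ h => absurd hmm h
      obtain ⟨z, hz, hz'⟩ := h.facet m hm
      filter_upwards [e z (hz' m₁ h₁ (Ne.symm hmm))] with δ hδ _ using ⟨z, hz, hz', hδ⟩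
    filter_upwards [e v (h.pos m₁ h₁), e₁, hB M₁ hη₂ m₁ (Set.mem_insert_of_mem _ (hK h₁)) q
      (Set.mem_insert _ _)] with δ a b c _ using ⟨a, b, c⟩
  set n := m₁ + (δ : ℝ) • q with hn
  have hnd : ∀ z, n ⬝ᵥ z = m₁ ⬝ᵥ z + (δ : ℝ) * (q ⬝ᵥ z) := fun z => by
    simp only [hn, add_dotProduct, smul_dotProduct, smul_eq_mul]
  have hnv : 0 < n ⬝ᵥ v := by rw [hnd]; exact hδv
  -- a point of the new facet
  set s := -(q ⬝ᵥ z₀) / (q ⬝ᵥ z₁) with hs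
  have hs0 : 0 < s := div_pos (neg_pos.2 hqz₀) hqz₁
  have hsq : s * (q ⬝ᵥ z₁) = -(q ⬝ᵥ z₀) := div_mul_cancel₀ _ hqz₁.ne'
  have hpos : ∀ t : ℝ, 0 < t → ∀ m ∈ K, m ≠ m₁ → 0 < m ⬝ᵥ (z₀ + t • z₁) := by
    intro t ht m hm hne
    rw [dotProduct_add, dotProduct_smul, smul_eq_mul]
    exact add_pos_of_nonneg_of_pos (hz m hm) (mul_pos ht (hz₁' m hm hne))
  have hm₁t : ∀ t : ℝ, m₁ ⬝ᵥ (z₀ + t • z₁) = 0 := by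
    intro t; simp [dotProduct_add, hz₁, hz₁₁]
  set zm := z₀ + (s / 2) • z₁ with hzm
  have hqzm : q ⬝ᵥ zm < 0 := by
    rw [hzm, dotProduct_add, dotProduct_smul, smul_eq_mul, div_mul_eq_mul_div, hsq]
    linarith
  set τ := -((δ : ℝ) * (q ⬝ᵥ zm)) / (n ⬝ᵥ v) with hτ
  have hτ0 : 0 < τ := div_pos (by nlinarith) hnv
  have hnew : n ⬝ᵥ (zm + τ • v) = 0 := by
    rw [dotProduct_add, dotProduct_smul, smul_eq_mul, hτ, div_mul_cancel₀ _ hnv.ne', hnd, hzm,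
      hm₁t]
    ring
  have hnew' : ∀ m ∈ K, 0 < m ⬝ᵥ (zm + τ • v) := by
    intro m hm
    rw [dotProduct_add, dotProduct_smul, smul_eq_mul]
    have := mul_pos hτ0 (h.pos m hm)
    by_cases hmm : m = m₁
    · have h0 : m ⬝ᵥ zm = 0 := by rw [hmm]; exact hm₁t _
      linarith
    · linarith [hpos (s / 2) (by positivity) m hm hmm]
  have hnK : n ∉ K := fun hc => (hnew' n hc).ne' hnew
  refine ⟨n, hnK, ⟨?_, ?_, ?_, ?_⟩, insert n M₁, hδB, ?_⟩
  · intro m hm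
    rcases Finset.mem_insert.1 hm with rfl | hm
    · have : IsRatVec q := by
        have := (h.rat m₂ h₂).add_smul (h.rat m₃ h₃) (-η)
        simpa [hq] using this
      exact (h.rat m₁ h₁).add_smul this δ
    · exact h.rat m hm
  · intro m hm
    rcases Finset.mem_insert.1 hm with rfl | hm
    · exact hnv
    · exact h.pos m hm
  · intro m hm
    rcases Finset.mem_insert.1 hm with rfl | hm
    · refine ⟨_, hnew, fun m' hm' hne => hnew' m' ?_⟩
      exact (Finset.mem_insert.1 hm').resolve_left hne
    · by_cases hmm : m = m₁
      · subst hmm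
        refine ⟨z₁, hz₁₁, fun m' hm' hne => ?_⟩
        rcases Finset.mem_insert.1 hm' with rfl | hm'
        · rw [hnd, hz₁₁, zero_add]; exact mul_pos hδ hqz₁
        · exact hz₁' m' hm' hne
      · obtain ⟨z, h0, h', hp⟩ := hδK m hm hmm
        refine ⟨z, h0, fun m' hm' hne => ?_⟩
        rcases Finset.mem_insert.1 hm' with rfl | hm'
        · rw [hnd]; exact hp
        · exact h' m' hm' hne
  · have hne₃ : m₃ ≠ m₁ := by rintro rfl; exact hz₃.ne' hz₁
    refine ⟨m₁, Finset.mem_insert_of_mem h₁, n, Finset.mem_insert_self _ _, m₃,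
      Finset.mem_insert_of_mem h₃, fun hc => hnK (hc ▸ h₁), z₀ + s • z₁, hm₁t s, ?_,
      hpos s hs0 m₃ h₃ hne₃, ?_⟩
    · rw [hnd, hm₁t, dotProduct_add, dotProduct_smul, smul_eq_mul, hsq]
      ring
    · intro m hm
      rcases Finset.mem_insert.1 hm with rfl | hm
      · rw [hnd, hm₁t, dotProduct_add, dotProduct_smul, smul_eq_mul, hsq]
        simp
      · by_cases hmm : m = m₁
        · rw [hmm, hm₁t]
        · exact (hpos s hs0 m hm hmm).le
  · rw [Finset.coe_insert]
    exact Set.insert_subset_insert (hK.trans (Set.subset_insert _ _))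

theorem exists_superset_card (h : IsFacetSystem K v) {B : Set (Fin d → ℝ) → Prop}
    (hB : ∀ M, B M → ∀ x ∈ M, ∀ y ∈ M, ∀ᶠ δ in 𝓝 (0 : ℝ), B (insert (x + δ • y) M))
    {M : Set (Fin d → ℝ)} (hM : B M) (hK : ↑K ⊆ M) {N : ℕ} (hN : K.card ≤ N) :
    ∃ K', K ⊆ K' ∧ K'.card = N ∧ IsFacetSystem K' v ∧ ∃ M', B M' ∧ ↑K' ⊆ M' := by
  classical
  induction N, hN using Nat.le_induction with
  | base => exact ⟨K, subset_rfl, rfl, h, M, hM, hK⟩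
  | succ N _ ih =>
    obtain ⟨K', hKK', hc, h', M', hM', hK'⟩ := ih
    obtain ⟨n, hn, h'', hM''⟩ := h'.exists_insert hB hM' hK'
    exact ⟨insert n K', hKK'.trans (Finset.subset_insert _ _),
      by rw [Finset.card_insert_of_notMem hn, hc], h'', hM''⟩

/-- Every finite system of strict rational inequalities in dimension at least three whose cone is
pointed contains a facet system defining the same cone. -/
theorem exists_subset (hd : 3 ≤ d) {K₀ : Finset (Fin d → ℝ)} (hrat : ∀ m ∈ K₀, IsRatVec m)
    (hpos : ∀ m ∈ K₀, 0 < m ⬝ᵥ v) (hpt : ∀ x, (∀ m ∈ K₀, m ⬝ᵥ x = 0) → x = 0) :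
    ∃ K ⊆ K₀, (∀ x, (∀ m ∈ K, 0 ≤ m ⬝ᵥ x) → ∀ m ∈ K₀, 0 ≤ m ⬝ᵥ x) ∧ IsFacetSystem K v := by
  classical
  obtain ⟨K, hK, hmin⟩ := Finset.exists_min_image
    (K₀.powerset.filter fun K => ∀ x, (∀ m ∈ K, 0 ≤ m ⬝ᵥ x) → ∀ m ∈ K₀, 0 ≤ m ⬝ᵥ x)
    Finset.card ⟨K₀, by simp⟩
  obtain ⟨hKK, hcone⟩ := Finset.mem_filter.1 hK
  rw [Finset.mem_powerset] at hKK
  have hptK : ∀ x, (∀ m ∈ K, m ⬝ᵥ x = 0) → x = 0 := by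
    intro x hx
    refine hpt x fun m hm => le_antisymm ?_ (hcone x (fun m hm => (hx m hm).ge) m hm)
    have := hcone (-x) (fun m hm => by simp [hx m hm]) m hm
    simpa using this
  have hfacet : ∀ m ∈ K, ∃ z, m ⬝ᵥ z = 0 ∧ ∀ m' ∈ K, m' ≠ m → 0 < m' ⬝ᵥ z := by
    intro m hm
    have hlt : ¬ ∀ x, (∀ m' ∈ K.erase m, 0 ≤ m' ⬝ᵥ x) → ∀ m ∈ K₀, 0 ≤ m ⬝ᵥ x := by
      intro hc
      refine absurd (hmin (K.erase m) ?_) (not_le.2 (Finset.card_erase_lt_of_mem hm))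
      exact Finset.mem_filter.2 ⟨Finset.mem_powerset.2 ((Finset.erase_subset _ _).trans hKK), hc⟩
    push Not at hlt
    obtain ⟨x, hx, m₀, hm₀, hneg⟩ := hlt
    have hmx : m ⬝ᵥ x < 0 := by
      by_contra! hc
      refine absurd (hcone x (fun m' hm' => ?_) m₀ hm₀) (not_le.2 hneg)
      by_cases hmm : m' = m
      · rwa [hmm]
      · exact hx m' (Finset.mem_erase.2 ⟨hmm, hm'⟩)
    refine ⟨(m ⬝ᵥ v) • x - (m ⬝ᵥ x) • v, ?_, fun m' hm' hne => ?_⟩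
    · simp only [dotProduct_sub, dotProduct_smul, smul_eq_mul]; ring
    · simp only [dotProduct_sub, dotProduct_smul, smul_eq_mul]
      have h1 := mul_nonneg (hpos m (hKK hm)).le (hx m' (Finset.mem_erase.2 ⟨hne, hm'⟩))
      have h2 := mul_pos_of_neg_of_neg hmx (neg_neg_of_pos (hpos m' (hKK hm')))
      linarith
  refine ⟨K, hKK, hcone, fun m hm => hrat m (hKK hm), fun m hm => hpos m (hKK hm), hfacet, ?_⟩
  obtain ⟨m₁, h₁⟩ : K.Nonempty := by
    rw [Finset.nonempty_iff_ne_empty]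
    rintro rfl
    have := congrFun (hptK (fun _ => 1) (by simp)) ⟨0, by omega⟩
    simp at this
  obtain ⟨z₁, hz₁, hz₁'⟩ := hfacet m₁ h₁
  -- a nonzero vector in the hyperplane of `m₁` that is not a multiple of `z₁`
  obtain ⟨x, hx0, hx₁, hxz⟩ : ∃ x : Fin d → ℝ, x ≠ 0 ∧ m₁ ⬝ᵥ x = 0 ∧ z₁ ⬝ᵥ x = 0 := by
    have hk : LinearMap.ker (Matrix.mulVecLin (Matrix.of ![m₁, z₁])) ≠ ⊥ :=
      LinearMap.ker_ne_bot_of_finrank_lt (by simp; omega)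
    obtain ⟨x, hx, hx0⟩ := (Submodule.ne_bot_iff _).1 hk
    have hx' : Matrix.mulVec (Matrix.of ![m₁, z₁]) x = 0 := hx
    exact ⟨x, hx0, congrFun hx' 0, congrFun hx' 1⟩
  obtain ⟨x, hx0, hx₁, hxz, hxneg⟩ : ∃ x : Fin d → ℝ, x ≠ 0 ∧ m₁ ⬝ᵥ x = 0 ∧ z₁ ⬝ᵥ x = 0 ∧
      ∃ m ∈ K, m ⬝ᵥ x < 0 := by
    by_cases hneg : ∃ m ∈ K, m ⬝ᵥ x < 0
    · exact ⟨x, hx0, hx₁, hxz, hneg⟩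
    · push Not at hneg
      refine ⟨-x, neg_ne_zero.2 hx0, by simp [hx₁], by simp [hxz], ?_⟩
      by_contra! hc
      refine hx0 (hptK x fun m hm => le_antisymm ?_ (hneg m hm))
      simpa using hc m hm
  obtain ⟨m₂, h₂, hmin₂⟩ := Finset.exists_min_image (K.filter fun m => m ⬝ᵥ x < 0)
    (fun m => (m ⬝ᵥ z₁) / (-(m ⬝ᵥ x))) (by
      obtain ⟨m, hm, hmx⟩ := hxneg
      exact ⟨m, Finset.mem_filter.2 ⟨hm, hmx⟩⟩)
  obtain ⟨h₂, hx₂⟩ := Finset.mem_filter.1 h₂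
  have h₂₁ : m₂ ≠ m₁ := by rintro rfl; exact hx₂.ne hx₁
  have hz₂ := hz₁' m₂ h₂ h₂₁
  set t := (m₂ ⬝ᵥ z₁) / (-(m₂ ⬝ᵥ x)) with ht
  have ht0 : 0 < t := div_pos hz₂ (neg_pos.2 hx₂)
  have hnn : ∀ m ∈ K, 0 ≤ m ⬝ᵥ (z₁ + t • x) := by
    intro m hm
    rw [dotProduct_add, dotProduct_smul, smul_eq_mul]
    have hmz : 0 ≤ m ⬝ᵥ z₁ := by
      by_cases hmm : m = m₁
      · rw [hmm, hz₁]
      · exact (hz₁' m hm hmm).le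
    rcases lt_or_ge (m ⬝ᵥ x) 0 with hneg | hge
    · have := hmin₂ m (Finset.mem_filter.2 ⟨hm, hneg⟩)
      rw [le_div_iff₀ (neg_pos.2 hneg)] at this
      linarith
    · exact add_nonneg hmz (mul_nonneg ht0.le hge)
  have hm₂ : m₂ ⬝ᵥ (z₁ + t • x) = 0 := by
    rw [dotProduct_add, dotProduct_smul, smul_eq_mul, ht]
    have := hx₂.ne
    field_simp
    ring
  obtain ⟨m₃, h₃, hm₃⟩ : ∃ m₃ ∈ K, 0 < m₃ ⬝ᵥ (z₁ + t • x) := by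
    by_contra! hc
    have h0 := hptK _ fun m hm => le_antisymm (hc m hm) (hnn m hm)
    have h1 : z₁ ⬝ᵥ (z₁ + t • x) = 0 := by rw [h0, dotProduct_zero]
    rw [dotProduct_add, dotProduct_smul, hxz, smul_zero, add_zero, dotProduct_self_eq_zero] at h1
    rw [h1] at hz₂
    simp at hz₂
  exact ⟨m₁, h₁, m₂, h₂, m₃, h₃, h₂₁.symm, z₁ + t • x,
    by rw [dotProduct_add, dotProduct_smul, hz₁, hx₁]; simp, hm₂, hm₃, hnn⟩

end IsFacetSystem

/-- A finite family of `d` vectors with trivial orthogonal complement has a dual basis. -/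
theorem exists_dual_basis {𝕜 : Type*} [Field 𝕜] {d f : ℕ} (a : Fin f → Fin d → 𝕜)
    {J : Set (Fin f)} (hJ : J.ncard = d) (hJ0 : ∀ x, (∀ j ∈ J, a j ⬝ᵥ x = 0) → x = 0) :
    ∃ w : Fin f → Fin d → 𝕜, (∀ j ∈ J, ∀ k, a j ⬝ᵥ w k = if j = k then 1 else 0) ∧
      ∀ k ∉ J, w k = 0 := by
  classical
  let T : (Fin d → 𝕜) →ₗ[𝕜] (J → 𝕜) := LinearMap.pi fun j => dotProductBilin 𝕜 𝕜 (a j)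
  have hT : ∀ x j, T x j = a j ⬝ᵥ x := fun x j => rfl
  have hinj : Function.Injective T := by
    refine (injective_iff_map_eq_zero T).2 fun x hx => hJ0 x fun j hj => ?_
    rw [← hT x ⟨j, hj⟩, hx]
    rfl
  have hsurj : Function.Surjective T := by
    refine (LinearMap.injective_iff_surjective_of_finrank_eq_finrank ?_).1 hinj
    simp [← hJ, Set.ncard_eq_toFinset_card']
  choose w hw using fun k : J => hsurj (Pi.single k 1)
  refine ⟨fun k => if hk : k ∈ J then w ⟨k, hk⟩ else 0, ?_, ?_⟩
  · intro j hj k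
    by_cases hk : k ∈ J
    · simp only [hk, dif_pos]
      rw [← hT _ ⟨j, hj⟩, hw, Pi.single_apply]
      simp
    · have : j ≠ k := fun h => hk (h ▸ hj)
      simp [hk, this]
  · intro k hk
    simp [hk]

/-- Expansion of a vector in a dual basis. -/
theorem eq_sum_dual_basis {𝕜 : Type*} [Field 𝕜] {d f : ℕ} {a : Fin f → Fin d → 𝕜}
    {J : Set (Fin f)} (hJ0 : ∀ x, (∀ j ∈ J, a j ⬝ᵥ x = 0) → x = 0) {w : Fin f → Fin d → 𝕜}
    (hw : ∀ j ∈ J, ∀ k, a j ⬝ᵥ w k = if j = k then 1 else 0) {x : Fin d → 𝕜} {c : Fin f → 𝕜}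
    (hx : ∀ j ∈ J, a j ⬝ᵥ x = c j) : x = ∑ k, c k • w k := by
  refine sub_eq_zero.1 (hJ0 _ fun j hj => ?_)
  simp [dotProduct_sub, dotProduct_sum, dotProduct_smul, hw j hj, hx j hj]

/-- The orthogonal complement of a spanning set is trivial. -/
theorem eq_zero_of_span_eq_top {d : ℕ} {s : Set (Fin d → ℝ)} (hs : Submodule.span ℝ s = ⊤)
    {x : Fin d → ℝ} (hx : ∀ p ∈ s, p ⬝ᵥ x = 0) : x = 0 := by
  have h : ∀ p ∈ Submodule.span ℝ s, p ⬝ᵥ x = 0 := by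
    intro p hp
    induction hp using Submodule.span_induction with
    | mem p hp => exact hx p hp
    | zero => simp
    | add p q _ _ hp hq => simp [add_dotProduct, hp, hq]
    | smul c p _ hp => simp [smul_dotProduct, hp]
  exact dotProduct_self_eq_zero.1 (h x (hs ▸ Submodule.mem_top))

/-- A set with trivial orthogonal complement is spanning. -/
theorem span_eq_top_of_forall {𝕜 : Type*} [Field 𝕜] {d : ℕ} {s : Set (Fin d → 𝕜)}
    (hs : ∀ x, (∀ p ∈ s, p ⬝ᵥ x = 0) → x = 0) : Submodule.span 𝕜 s = ⊤ := by
  by_contra hne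
  obtain ⟨φ, hφ, hle⟩ := Submodule.exists_le_ker_of_lt_top _ (lt_top_iff_ne_top.2 hne)
  refine hφ (LinearMap.ext fun y => ?_)
  have hy : ∀ y, φ y = y ⬝ᵥ fun i => φ (Pi.single i 1) := by
    intro y
    conv_lhs => rw [← Finset.univ_sum_single y, map_sum]
    refine Finset.sum_congr rfl fun i _ => ?_
    rw [← smul_eq_mul, ← map_smul, ← Pi.single_smul, smul_eq_mul, mul_one]
  have h0 := hs (fun i => φ (Pi.single i 1)) fun p hp => by
    rw [← hy]
    exact hle (Submodule.subset_span hp)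
  rw [hy, h0]
  simp

/-- Bounded `d`-dimensional spindles with `2d - 1` facets at one apex and `d` facets at the other
have non-revisiting circuit walks of length at most `d` between the apices. -/
def SpindleProperty (d : ℕ) : Prop :=
  ∀ (P : PolyData d (3*d - 1)) (u v : Fin d → ℝ), P.IsProper →
    Bornology.IsBounded P.toSet → P.IsVertex u → P.IsVertex v →
    Disjoint (P.activeAt u) (P.activeAt v) →
    P.activeAt u ∪ P.activeAt v = Set.univ →
    (P.activeAt u).ncard = 2*d - 1 → (P.activeAt v).ncard = d →
      ∃ (m : ℕ) (y : Fin (m+1) → Fin d → ℝ), m ≤ d ∧ P.IsCircuitWalk y ∧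
        P.IsNonRevisiting y ∧ y 0 = u ∧ y (Fin.last m) = v

/-- The spindle property for spindles whose facets are indexed by an arbitrary finite type. -/
theorem SpindleProperty.exists_walk {d : ℕ} (h : SpindleProperty d) {κ : Type*} [Fintype κ]
    (hκ : Fintype.card κ = 3 * d - 1) {r : κ → Fin d → ℝ} {s : κ → ℝ}
    (hr : ∀ k, IsRatVec (r k)) (hs : ∀ k, ∃ q : ℚ, s k = q) {u v : Fin d → ℝ} {L : Set κ}
    (hint : ∃ z, ∀ k, s k < r k ⬝ᵥ z)
    (hfacet : ∀ k, ∃ z, r k ⬝ᵥ z = s k ∧ ∀ k', k' ≠ k → s k' < r k' ⬝ᵥ z)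
    (hbdd : Bornology.IsBounded {z | ∀ k, s k ≤ r k ⬝ᵥ z})
    (hu : ∀ k ∈ L, r k ⬝ᵥ u = s k) (hu' : ∀ k ∉ L, s k < r k ⬝ᵥ u)
    (hv : ∀ k ∉ L, r k ⬝ᵥ v = s k) (hv' : ∀ k ∈ L, s k < r k ⬝ᵥ v)
    (hL : ∀ x, (∀ k ∈ L, r k ⬝ᵥ x = 0) → x = 0) (hLc : ∀ x, (∀ k ∉ L, r k ⬝ᵥ x = 0) → x = 0)
    (hcL : L.ncard = 2 * d - 1) (hcLc : Lᶜ.ncard = d) :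
    ∃ m ≤ d, ∃ (j : Fin m → κ) (y : ℕ → Fin d → ℝ) (g : Fin m → Fin d → ℝ) (α : Fin m → ℝ),
      y 0 = u ∧ y m = v ∧ (∀ i ≤ m, ∀ k, s k ≤ r k ⬝ᵥ y i) ∧
      (∀ i : Fin m, j i ∉ L ∧ g i ≠ 0 ∧ IsCircuitOf (Set.range r) (g i) ∧ 0 ≤ α i ∧
        y (i + 1) = y i + α i • g i ∧ r (j i) ⬝ᵥ y (i + 1) = s (j i)) ∧
      Function.Injective j := by
  obtain ⟨e⟩ : Nonempty (Fin (3 * d - 1) ≃ κ) := ⟨Fintype.equivOfCardEq (by simp [hκ])⟩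
  choose q hq using hr
  choose q' hq' using hs
  let S : PolyData d (3 * d - 1) := ⟨fun k => q (e k), fun k => q' (e k)⟩
  have hrow : ∀ k, S.row k = r (e k) := fun k => (hq (e k)).symm
  have hrhs : ∀ k, S.rhs k = s (e k) := fun k => (hq' (e k)).symm
  have heval : ∀ k z, S.eval k z = r (e k) ⬝ᵥ z := fun k z => by
    rw [PolyData.eval_eq_dotProduct, hrow]
  have hset : S.toSet = {z | ∀ k, s k ≤ r k ⬝ᵥ z} := by
    ext z
    simp only [PolyData.toSet, hrhs, heval, Set.mem_ofPred_eq]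
    exact e.forall_congr_left.trans (by simp)
  have hrange : Set.range S.row = Set.range r := by
    rw [show S.row = r ∘ e from funext hrow, e.surjective.range_comp]
  have hau : S.activeAt u = e ⁻¹' L := by
    ext k
    simp only [PolyData.activeAt, hrhs, heval, Set.mem_ofPred_eq, Set.mem_preimage]
    exact ⟨fun h0 => by_contra fun hk => (hu' _ hk).ne' h0, fun hk => hu _ hk⟩
  have hav : S.activeAt v = e ⁻¹' Lᶜ := by
    ext k
    simp only [PolyData.activeAt, hrhs, heval, Set.mem_ofPred_eq, Set.mem_preimage]
    exact ⟨fun h0 hk => (hv' _ hk).ne' h0, fun hk => hv _ hk⟩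
  have hfu : ∀ k, s k ≤ r k ⬝ᵥ u := fun k => by
    by_cases hk : k ∈ L
    · exact (hu k hk).ge
    · exact (hu' k hk).le
  have hfv : ∀ k, s k ≤ r k ⬝ᵥ v := fun k => by
    by_cases hk : k ∈ L
    · exact (hv' k hk).le
    · exact (hv k hk).ge
  have hspan : ∀ T : Set κ, (∀ x, (∀ k ∈ T, r k ⬝ᵥ x = 0) → x = 0) →
      Submodule.span ℝ (S.row '' (e ⁻¹' T)) = ⊤ := by
    refine fun T hT => span_eq_top_of_forall fun x hx => hT x fun k hk => ?_
    have := hx (S.row (e.symm k)) ⟨e.symm k, by simpa using hk, rfl⟩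
    simpa [hrow] using this
  have hprop : S.IsProper := by
    refine ⟨?_, fun k => ?_⟩
    · obtain ⟨z, hz⟩ := hint
      exact ⟨z, fun k => by rw [hrhs, heval]; exact hz _⟩
    · obtain ⟨z, hz, hz'⟩ := hfacet (e k)
      have hlt : ∀ k', k' ≠ k → S.rhs k' < S.eval k' z := fun k' hk' => by
        rw [hrhs, heval]
        exact hz' _ (e.injective.ne hk')
      have heq : S.eval k z = S.rhs k := by rw [hrhs, heval, hz]
      refine ⟨z, fun k' => ?_, heq, hlt⟩
      by_cases hk' : k' = k
      · rw [hk', heq]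
      · exact (hlt k' hk').le
  obtain ⟨m, y, hm, ⟨hy, hstep⟩, hnr, hy0, hym⟩ := h S u v hprop (hset ▸ hbdd)
    ⟨hset ▸ hfu, hau ▸ hspan L hL⟩ ⟨hset ▸ hfv, hav ▸ hspan Lᶜ hLc⟩
    (by rw [hau, hav]; exact disjoint_compl_right.preimage _)
    (by rw [hau, hav, ← Set.preimage_union, Set.union_compl_self, Set.preimage_univ])
    (by rw [hau, Set.ncard_preimage_of_injective_subset_range e.injective (by simp), hcL])
    (by rw [hav, Set.ncard_preimage_of_injective_subset_range e.injective (by simp), hcLc])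
  choose g hg α hα hyg _ using hstep
  choose j hj hj' using hnr
  have hlt : ∀ n, min n m < m + 1 := fun n => by omega
  have hidx : ∀ i : Fin m, (⟨min (i : ℕ) m, hlt _⟩ : Fin (m + 1)) = i.castSucc := fun i =>
    Fin.ext (min_eq_left i.2.le)
  have hidx' : ∀ i : Fin m, (⟨min ((i : ℕ) + 1) m, hlt _⟩ : Fin (m + 1)) = i.succ := fun i =>
    Fin.ext (min_eq_left i.2)
  refine ⟨m, hm, fun i => e (j i), fun n => y ⟨min n m, hlt n⟩, g, α, ?_, ?_, ?_, ?_, ?_⟩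
  · simpa using hy0
  · simp only [min_self]
    exact hym
  · intro i _ k
    have := hy ⟨min i m, hlt i⟩
    rw [hset] at this
    exact this k
  · intro i
    simp only [hidx, hidx']
    refine ⟨fun hL => hj' i 0 (Fin.zero_le _) ?_, (hg i).1, ?_, (hα i).le, hyg i, ?_⟩
    · rw [hy0, hau]
      exact hL
    · rw [← hrange]
      refine PolyData.IsCircuit.isCircuitOf (hg i) fun x hx => hL x fun k _ => ?_
      simpa [hrow] using hx (e.symm k)
    · have := hj i
      rw [PolyData.activeAt, Set.mem_ofPred_eq, heval, hrhs] at this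
      exact this
  · have hne : ∀ i i' : Fin m, i < i' → j i ≠ j i' := fun i i' hii heq =>
      hj' i' i.succ (by rw [Fin.le_def]; simpa using hii) (heq ▸ hj i)
    intro i i' hii
    have hii := e.injective hii
    rcases lt_trichotomy i i' with h1 | h1 | h1
    · exact absurd hii (hne _ _ h1)
    · exact h1
    · exact absurd hii.symm (hne _ _ h1)

/-- Finitely many positive affine functions stay positive for a small positive argument. -/
theorem exists_pos_forall_add_mul_pos {κ : Type*} [Finite κ] (c e : κ → ℝ) (hc : ∀ k, 0 < c k) :
    ∃ t : ℝ, 0 < t ∧ ∀ k, 0 < c k + t * e k := by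
  have h : ∀ᶠ t in 𝓝 (0 : ℝ), 0 < t → ∀ k, 0 < c k + t * e k := by
    refine (eventually_all.2 fun k => ?_).mono fun t ht _ => ht
    have hcont : ContinuousAt (fun t : ℝ => c k + t * e k) 0 := by fun_prop
    exact hcont.eventually (lt_mem_nhds (by simpa using hc k))
  obtain ⟨t, ht, ht'⟩ := exists_rat_pos_of_eventually h
  exact ⟨t, ht, ht'⟩

/-- The constraints `a k ⬝ᵥ x ≥ β k` describe a Dantzig figure with apices `u` and `v`, where `J`
indexes the facets at `v`. The constraint vectors and `u` are rational. -/
structure IsDantzig {d f : ℕ} (a : Fin f → Fin d → ℝ) (J : Set (Fin f)) (u v : Fin d → ℝ)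
    (β : Fin f → ℝ) : Prop where
  rat : ∀ k, IsRatVec (a k)
  rat_u : IsRatVec u
  eq_u : ∀ k ∉ J, a k ⬝ᵥ u = β k
  lt_u : ∀ k ∈ J, β k < a k ⬝ᵥ u
  eq_v : ∀ k ∈ J, a k ⬝ᵥ v = β k
  lt_v : ∀ k ∉ J, β k < a k ⬝ᵥ v
  eq_zero_u : ∀ x, (∀ k ∉ J, a k ⬝ᵥ x = 0) → x = 0
  eq_zero_v : ∀ x, (∀ k ∈ J, a k ⬝ᵥ x = 0) → x = 0
  ncard : J.ncard = d
  ncard_compl : Jᶜ.ncard = d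

theorem IsRatVec.dotProduct {d : ℕ} {x y : Fin d → ℝ} (hx : IsRatVec x) (hy : IsRatVec y) :
    ∃ q : ℚ, x ⬝ᵥ y = q := by
  obtain ⟨q, rfl⟩ := hx
  obtain ⟨r, rfl⟩ := hy
  exact ⟨q ⬝ᵥ r, by simp [_root_.dotProduct]⟩

namespace IsDantzig

variable {d f : ℕ} {a : Fin f → Fin d → ℝ} {J : Set (Fin f)} {u v : Fin d → ℝ} {β : Fin f → ℝ}

/-- Replacing the cone at `u` by a smaller rational one with `2d - 1` facets, such that a bounded
spindle arises. -/
theorem hasWalk_of_isFacetSystem (D : IsDantzig a J u v β) (h : SpindleProperty d)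
    (hβ : ∀ k, ∃ q : ℚ, β k = q) {K : Finset (Fin d → ℝ)} (hK : IsFacetSystem K (v - u))
    (hc : K.card = 2 * d - 1) {M : Set (Fin d → ℝ)} (hKM : ↑K ⊆ M) (haM : Set.range a ⊆ M) {R : ℝ}
    (hKa : ∀ x, (∀ m ∈ K, 0 ≤ m ⬝ᵥ x) → ∀ k ∉ J, 0 ≤ a k ⬝ᵥ x)
    (hR : ∀ x, (∀ m ∈ K, 0 ≤ m ⬝ᵥ (x - u)) → (∀ k ∈ J, β k ≤ a k ⬝ᵥ x) → ‖x‖ ≤ R) :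
    HasWalk a J u R d (fun g _ => IsCircuitOf M g) β := by
  classical
  obtain ⟨w, hw, -⟩ := exists_dual_basis a D.ncard D.eq_zero_v
  have hd : 0 < d := by
    rcases Nat.eq_zero_or_pos d with rfl | hd
    · obtain ⟨m₁, h₁, m₂, h₂, m₃, h₃, h₁₂, -⟩ := hK.ridge
      exact absurd (Subsingleton.elim _ _) h₁₂
    · exact hd
  have hposK : ∀ m ∈ K, m ⬝ᵥ u < m ⬝ᵥ v := fun m hm => by
    have := hK.pos m hm
    rw [dotProduct_sub] at this
    linarith
  let r : K ⊕ J → Fin d → ℝ := Sum.elim (fun m => m) fun j => a j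
  let s : K ⊕ J → ℝ := Sum.elim (fun m => m.1 ⬝ᵥ u) fun j => β j
  have hJcard : Fintype.card J = d := by
    rw [← Nat.card_eq_fintype_card, ← D.ncard]
    rfl
  have hLc : (Set.range (Sum.inl : K → K ⊕ J))ᶜ = Set.range Sum.inr :=
    Set.isCompl_range_inl_range_inr.compl_eq
  have hr : ∀ k, IsRatVec (r k) := by
    rintro (m | j)
    · exact hK.rat m m.2
    · exact D.rat j
  have hs : ∀ k, ∃ q : ℚ, s k = q := by
    rintro (m | j)
    · exact (hK.rat m m.2).dotProduct D.rat_u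
    · exact hβ j
  have hfacet : ∀ k, ∃ z, r k ⬝ᵥ z = s k ∧ ∀ k', k' ≠ k → s k' < r k' ⬝ᵥ z := by
    rintro (m | j)
    · obtain ⟨z, hz, hz'⟩ := hK.facet m m.2
      obtain ⟨t, ht, ht'⟩ := exists_pos_forall_add_mul_pos (fun j : J => a j ⬝ᵥ u - β j)
        (fun j => a j ⬝ᵥ z) fun j => sub_pos.2 (D.lt_u j j.2)
      refine ⟨u + t • z, ?_, ?_⟩
      · simp [r, s, dotProduct_add, dotProduct_smul, hz]
      · rintro (m' | j) hne
        · have := mul_pos ht (hz' m' m'.2 fun h => hne (congrArg Sum.inl (Subtype.ext h)))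
          simpa [r, s, dotProduct_add, dotProduct_smul] using this
        · have := ht' j
          simp only [r, s, dotProduct_add, dotProduct_smul, smul_eq_mul, Sum.elim_inr]
          linarith
    · have hz : ∀ k : J, a k ⬝ᵥ (∑ i, w i - w j) = if k = j then 0 else 1 := by
        intro k
        simp [dotProduct_sub, dotProduct_sum, hw k k.2, Subtype.ext_iff]
        split_ifs <;> simp
      obtain ⟨t, ht, ht'⟩ := exists_pos_forall_add_mul_pos (fun m : K => m.1 ⬝ᵥ v - m.1 ⬝ᵥ u)
        (fun m => m.1 ⬝ᵥ (∑ i, w i - w j)) fun m => sub_pos.2 (hposK m m.2)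
      refine ⟨v + t • (∑ i, w i - w j), ?_, ?_⟩
      · simp only [r, s, dotProduct_add, dotProduct_smul, smul_eq_mul, Sum.elim_inr, hz]
        simp [D.eq_v j j.2]
      · rintro (m | k) hne
        · have := ht' m
          simp only [r, s, dotProduct_add, dotProduct_smul, smul_eq_mul, Sum.elim_inl]
          linarith
        · have hkj : k ≠ j := fun h => hne (congrArg Sum.inr h)
          simp only [r, s, dotProduct_add, dotProduct_smul, smul_eq_mul, Sum.elim_inr, hz,
            if_neg hkj, D.eq_v k k.2]
          linarith
  have hpt : ∀ x, (∀ m ∈ K, m ⬝ᵥ x = 0) → x = 0 := fun x hx => by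
    refine D.eq_zero_u x fun k hk => le_antisymm ?_ (hKa x (fun m hm => (hx m hm).ge) k hk)
    have := hKa (-x) (fun m hm => by simp [hx m hm]) k hk
    simpa using this
  obtain ⟨m, hm, j, y, g, α, hy0, hym, hy, hstep, hj⟩ := h.exists_walk (κ := K ⊕ J)
    (by rw [Fintype.card_sum, hJcard, Fintype.card_coe, hc]; omega) (r := r) (s := s) (u := u)
    (v := v) (L := Set.range Sum.inl) hr hs
    ⟨(1 / 2 : ℝ) • (u + v), by
      rintro (m | j)
      · have := hposK m m.2
        simp only [r, s, dotProduct_smul, dotProduct_add, Sum.elim_inl, smul_eq_mul]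
        linarith
      · have := D.lt_u j j.2
        have := D.eq_v j j.2
        simp only [r, s, dotProduct_smul, dotProduct_add, Sum.elim_inr, smul_eq_mul]
        linarith⟩ hfacet
    ((Metric.isBounded_closedBall (x := 0) (r := R)).subset fun z hz => by
      rw [mem_closedBall_zero_iff]
      refine hR z (fun m hm => ?_) fun k hk => hz (Sum.inr ⟨k, hk⟩)
      have : m ⬝ᵥ u ≤ m ⬝ᵥ z := hz (Sum.inl ⟨m, hm⟩)
      rw [dotProduct_sub]
      linarith)
    (by rintro _ ⟨m, rfl⟩; rfl)
    (by
      intro k hk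
      obtain ⟨j, rfl⟩ : k ∈ Set.range Sum.inr := hLc ▸ hk
      exact D.lt_u j j.2)
    (by
      intro k hk
      obtain ⟨j, rfl⟩ : k ∈ Set.range Sum.inr := hLc ▸ hk
      exact D.eq_v j j.2)
    (by rintro _ ⟨m, rfl⟩; exact hposK m m.2)
    (fun x hx => hpt x fun m hm => hx _ ⟨⟨m, hm⟩, rfl⟩)
    (fun x hx => D.eq_zero_v x fun k hk => hx (Sum.inr ⟨k, hk⟩) (by simp))
    (by
      rw [← Set.image_univ, Set.ncard_image_of_injective _ Sum.inl_injective, Set.ncard_univ,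
        Nat.card_eq_fintype_card, Fintype.card_coe, hc])
    (by
      rw [hLc, ← Set.image_univ, Set.ncard_image_of_injective _ Sum.inr_injective, Set.ncard_univ,
        Nat.card_eq_fintype_card, hJcard])
  have hj' : ∀ i, ∃ k : J, j i = Sum.inr k := fun i => by
    obtain ⟨k, hk⟩ : j i ∈ Set.range Sum.inr := hLc ▸ (hstep i).1
    exact ⟨k, hk.symm⟩
  choose j' hj' using hj'
  have hyK : ∀ i ≤ m, ∀ p ∈ K, 0 ≤ p ⬝ᵥ (y i - u) := fun i hi p hp => by
    rw [dotProduct_sub, sub_nonneg]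
    exact hy i hi (Sum.inl ⟨p, hp⟩)
  refine ⟨m, hm, fun i => j' i, y, fun i => ‖g i‖⁻¹ • g i, fun i => α i * ‖g i‖, hy0,
    ?_, ?_, ?_, ?_⟩
  · exact fun k hk => hym ▸ D.eq_v k hk
  · refine fun i hi => ⟨hR _ (hyK i hi) fun k hk => hy i hi (Sum.inr ⟨k, hk⟩), fun k => ?_⟩
    by_cases hk : k ∈ J
    · exact hy i hi (Sum.inr ⟨k, hk⟩)
    · have := hKa _ (hyK i hi) k hk
      rw [dotProduct_sub, D.eq_u k hk] at this
      linarith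
  · intro i
    obtain ⟨-, hg0, hg, hα, hyi, hji⟩ := hstep i
    have hn : ‖g i‖ ≠ 0 := norm_ne_zero_iff.2 hg0
    refine ⟨(j' i).2, by simp [norm_smul, hn], ?_, by positivity, ?_, ?_⟩
    · refine (hg.mono ?_).smul (inv_ne_zero hn)
      rintro _ ⟨p | k, rfl⟩
      · exact hKM p.2
      · exact haM ⟨k, rfl⟩
    · rw [hyi, smul_smul, mul_assoc, mul_inv_cancel₀ hn, mul_one]
    · rw [hj' i] at hji
      exact hji
  · intro i i' hii
    refine hj ?_
    rw [hj', hj', Subtype.ext hii]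

end IsDantzig

theorem IsRatVec.neg {d : ℕ} {x : Fin d → ℝ} (hx : IsRatVec x) : IsRatVec (-x) := by
  obtain ⟨q, rfl⟩ := hx
  exact ⟨-q, by ext i; simp⟩

/-- A property which fails frequently near `0` fails along an ultrafilter converging to `0`. -/
theorem eventually_of_forall_ultrafilter {X : Type*} {F : Filter X} {p : X → Prop}
    (h : ∀ l : Ultrafilter X, (l : Filter X) ≤ F → ¬ ∀ᶠ x in l, ¬ p x) : ∀ᶠ x in F, p x := by
  by_contra hp
  have : NeBot (F ⊓ 𝓟 {x | ¬ p x}) := frequently_mem_iff_neBot.1 (not_eventually.1 hp)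
  have hle := Ultrafilter.of_le (F ⊓ 𝓟 {x | ¬ p x})
  exact h _ (hle.trans inf_le_left) (le_principal_iff.1 (hle.trans inf_le_right))

namespace IsDantzig

variable {d f : ℕ} {a : Fin f → Fin d → ℝ} {J : Set (Fin f)} {u v : Fin d → ℝ} {β : Fin f → ℝ}

/-- The apex `v` moves continuously with the facets through it. -/
theorem exists_perturb (D : IsDantzig a J u v β) :
    ∃ V : (Fin f → ℝ) → Fin d → ℝ, Continuous V ∧ V β = v ∧
      ∀ᶠ β' in 𝓝 β, (∀ k ∉ J, β' k = β k) → IsDantzig a J u (V β') β' := by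
  classical
  obtain ⟨w, hw, -⟩ := exists_dual_basis a D.ncard D.eq_zero_v
  let V : (Fin f → ℝ) → Fin d → ℝ := fun β' => v + ∑ k, (β' k - β k) • w k
  have hV : Continuous V := by fun_prop
  have hVβ : V β = v := by simp [V]
  have h1 : ∀ᶠ β' in 𝓝 β, ∀ k ∈ J, β' k < a k ⬝ᵥ u :=
    (eventually_all_finite (Set.toFinite J)).2 fun k hk =>
      (continuous_apply k).continuousAt.eventually (gt_mem_nhds (D.lt_u k hk))
  have h2 : ∀ᶠ β' in 𝓝 β, ∀ k ∈ Jᶜ, β k < a k ⬝ᵥ V β' :=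
    (eventually_all_finite (Set.toFinite Jᶜ)).2 fun k hk =>
      (continuous_const.dotProduct hV).continuousAt.eventually
        (lt_mem_nhds (by simpa only [hVβ] using D.lt_v k hk))
  refine ⟨V, hV, hVβ, (h1.and h2).mono fun β' ⟨h1, h2⟩ hβ' => ?_⟩
  exact { D with
    eq_u := fun k hk => (D.eq_u k hk).trans (hβ' k hk).symm
    lt_u := h1
    eq_v := fun k hk => by
      simp [V, dotProduct_add, dotProduct_sum, dotProduct_smul, hw k hk, D.eq_v k hk]
    lt_v := fun k hk => hβ' k hk ▸ h2 k hk }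

/-- Reversing all but one of the constraints in `J` at `u` makes the polyhedron bounded. -/
theorem exists_bound (D : IsDantzig a J u v β) (hd : 0 < d) :
    ∃ j ∈ J, ∃ R, ∀ x, (∀ k ∉ J, β k ≤ a k ⬝ᵥ x) → (∀ k ∈ J, k ≠ j → a k ⬝ᵥ x ≤ a k ⬝ᵥ u) →
      (∀ k ∈ J, β k - 2 ≤ a k ⬝ᵥ x) → ‖x‖ ≤ R := by
  classical
  obtain ⟨w, hw, hw0⟩ := exists_dual_basis a D.ncard D.eq_zero_v
  obtain ⟨i, hi⟩ : Jᶜ.Nonempty :=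
    Set.nonempty_of_ncard_ne_zero (by rw [D.ncard_compl]; exact hd.ne')
  obtain ⟨j, hj, hij⟩ : ∃ j ∈ J, a i ⬝ᵥ w j < 0 := by
    by_contra! hcon
    have h1 : u - v = ∑ k, (a k ⬝ᵥ (u - v)) • w k :=
      eq_sum_dual_basis D.eq_zero_v hw fun _ _ => rfl
    have h2 : 0 ≤ a i ⬝ᵥ (u - v) := by
      rw [h1, dotProduct_sum]
      refine Finset.sum_nonneg fun k _ => ?_
      by_cases hk : k ∈ J
      · have := D.lt_u k hk
        have := D.eq_v k hk
        rw [dotProduct_smul, dotProduct_sub]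
        exact mul_nonneg (by linarith) (hcon k hk)
      · simp [hw0 k hk]
    have := D.eq_u i hi
    have := D.lt_v i hi
    rw [dotProduct_sub] at h2
    linarith
  set C : Fin f → ℝ := fun k => a k ⬝ᵥ u - β k + 2 with hC
  set C' : ℝ := C j + (∑ k, |C k| * |a i ⬝ᵥ w k|) / (-(a i ⬝ᵥ w j)) with hC'
  refine ⟨j, hj, ‖u‖ + ∑ k, (if k = j then C' else C k) * ‖w k‖, fun x h1 h2 h3 => ?_⟩
  have hx : x - u = ∑ k, (a k ⬝ᵥ (x - u)) • w k :=
    eq_sum_dual_basis D.eq_zero_v hw fun _ _ => rfl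
  have hs : ∀ k ∈ J, k ≠ j → |a k ⬝ᵥ (x - u)| ≤ C k := fun k hk hkj => by
    have := h2 k hk hkj
    have := h3 k hk
    rw [dotProduct_sub, abs_le, hC]
    constructor <;> linarith [D.lt_u k hk]
  have hCj : 0 ≤ C j := by
    have := D.lt_u j hj
    simp only [hC]
    linarith
  have hpos : 0 < -(a i ⬝ᵥ w j) := by linarith
  have hS : 0 ≤ (∑ k, |C k| * |a i ⬝ᵥ w k|) / (-(a i ⬝ᵥ w j)) := by positivity
  have hsj : |a j ⬝ᵥ (x - u)| ≤ C' := by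
    rw [abs_le]
    constructor
    · have := h3 j hj
      rw [dotProduct_sub]
      simp only [hC] at hC'
      linarith
    · refine le_trans ?_ (le_add_of_nonneg_left hCj)
      rw [le_div_iff₀ hpos]
      have h4 : 0 ≤ a i ⬝ᵥ (x - u) := by
        rw [dotProduct_sub, D.eq_u i hi, sub_nonneg]
        exact h1 i hi
      rw [hx, dotProduct_sum, ← Finset.add_sum_erase _ _ (Finset.mem_univ j)] at h4
      have h5 : ∑ k ∈ Finset.univ.erase j, a i ⬝ᵥ ((a k ⬝ᵥ (x - u)) • w k) ≤
          ∑ k, |C k| * |a i ⬝ᵥ w k| := by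
        refine le_trans (Finset.sum_le_sum fun k hk => ?_)
          (Finset.sum_le_sum_of_subset_of_nonneg (Finset.erase_subset _ _)
            fun _ _ _ => by positivity)
        rw [dotProduct_smul, smul_eq_mul]
        refine (le_abs_self _).trans ?_
        rw [abs_mul]
        by_cases hkJ : k ∈ J
        · exact mul_le_mul_of_nonneg_right
            ((hs k hkJ (Finset.ne_of_mem_erase hk)).trans (le_abs_self _)) (abs_nonneg _)
        · simp [hw0 k hkJ]
      rw [dotProduct_smul, smul_eq_mul] at h4
      linarith
  have hnorm : ‖x - u‖ ≤ ∑ k, (if k = j then C' else C k) * ‖w k‖ := by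
    conv_lhs => rw [hx]
    refine (norm_sum_le _ _).trans (Finset.sum_le_sum fun k _ => ?_)
    rw [norm_smul]
    by_cases hk : k ∈ J
    · refine mul_le_mul_of_nonneg_right ?_ (norm_nonneg _)
      rw [Real.norm_eq_abs]
      split_ifs with hkj
      · rw [hkj]
        exact hsj
      · exact hs k hk hkj
    · simp [hw0 k hk]
  calc ‖x‖ = ‖u + (x - u)‖ := by rw [add_sub_cancel]
    _ ≤ _ := (norm_add_le _ _).trans (by gcongr)

/-- A Dantzig figure with arbitrary real right-hand sides has a short walk of circuits with
pairwise different target facets. -/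
theorem hasWalk (D : IsDantzig a J u v β) (h : SpindleProperty d) (hd : 3 ≤ d) {j : Fin f}
    (hj : j ∈ J) {R : ℝ}
    (hR : ∀ x, (∀ k ∉ J, β k ≤ a k ⬝ᵥ x) → (∀ k ∈ J, k ≠ j → a k ⬝ᵥ x ≤ a k ⬝ᵥ u) →
      (∀ k ∈ J, β k - 1 ≤ a k ⬝ᵥ x) → ‖x‖ ≤ R) :
    HasWalk a J u R d (fun g _ => IsCircuitOf (Set.range a) g) β := by
  classical
  by_contra hnot
  let B : Set (Fin d → ℝ) → Prop := fun M => M.Finite ∧ Set.range a ⊆ M ∧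
    ¬ HasWalk a J u R d (fun g _ => IsCircuitOf M g) β
  have hB : ∀ M, B M → ∀ x ∈ M, ∀ y ∈ M, ∀ᶠ δ in 𝓝 (0 : ℝ), B (insert (x + δ • y) M) := by
    rintro M ⟨hM, haM, hw⟩ x hx y hy
    refine eventually_of_forall_ultrafilter fun l hl hcon => hw ?_
    refine HasWalk.of_tendsto (l := l) (β' := fun _ => β) tendsto_const_nhds
      (D' := fun δ g _ => IsCircuitOf (insert (x + δ • y) M) g) (fun G g _ hG hg hg1 =>
        IsCircuitOf.of_tendsto hM hx hy (tendsto_id.mono_left hl) hG hg fun h0 => ?_) ?_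
    · simp [h0] at hg1
    · refine hcon.mono fun δ hδ => ?_
      by_contra h0
      exact hδ ⟨hM.insert _, haM.trans (Set.subset_insert _ _), h0⟩
  let r : Fin f → Fin d → ℝ := fun k => if k ∈ J then -a k else a k
  have hB₀ : B (Set.range a ∪ {p | -p ∈ Set.range a}) :=
    ⟨(Set.finite_range a).union ((Set.finite_range a).preimage neg_injective.injOn),
      Set.subset_union_left, fun hw => hnot (hw.mono fun g _ hg => hg.of_union_neg)⟩
  have hr : ∀ k ∈ Finset.univ.erase j, r k ∈ (Finset.univ.erase j).image r :=
    fun k hk => Finset.mem_image_of_mem _ hk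
  have hne : ∀ k ∉ J, k ≠ j := fun k hk hkj => hk (hkj ▸ hj)
  obtain ⟨K, hKK, hcone, hK⟩ := IsFacetSystem.exists_subset (v := v - u) hd
    (K₀ := (Finset.univ.erase j).image r) (by
      intro m hm
      obtain ⟨k, -, rfl⟩ := Finset.mem_image.1 hm
      by_cases hk : k ∈ J
      · simpa [r, hk] using (D.rat k).neg
      · simpa [r, hk] using D.rat k) (by
      intro m hm
      obtain ⟨k, -, rfl⟩ := Finset.mem_image.1 hm
      by_cases hk : k ∈ J
      · have := D.lt_u k hk
        have := D.eq_v k hk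
        simp only [r, hk, if_true, neg_dotProduct, dotProduct_sub]
        linarith
      · have := D.lt_v k hk
        have := D.eq_u k hk
        simp only [r, hk, if_false, dotProduct_sub]
        linarith)
    (fun x hx => D.eq_zero_u x fun k hk => by
      simpa [r, hk] using hx (r k) (hr k (by simp [hne k hk])))
  have hf : f = 2 * d := by
    have := Set.ncard_add_ncard_compl J
    rw [D.ncard, D.ncard_compl, Nat.card_eq_fintype_card, Fintype.card_fin] at this
    omega
  obtain ⟨K', hKK', hc, hK', M, ⟨hM, haM, hw⟩, hKM⟩ := hK.exists_superset_card hB hB₀ (by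
      intro m hm
      obtain ⟨k, -, rfl⟩ := Finset.mem_image.1 (hKK hm)
      by_cases hk : k ∈ J
      · exact Or.inr ⟨k, by simp [r, hk]⟩
      · exact Or.inl ⟨k, by simp [r, hk]⟩) (N := 2 * d - 1) (by
      refine (Finset.card_le_card hKK).trans (Finset.card_image_le.trans ?_)
      simp [Finset.card_erase_of_mem, hf])
  have hcone' : ∀ x, (∀ m ∈ K', 0 ≤ m ⬝ᵥ x) → ∀ k ≠ j, 0 ≤ r k ⬝ᵥ x := fun x hx k hk =>
    hcone x (fun m hm => hx m (hKK' hm)) _ (hr k (by simp [hk]))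
  have hconeI : ∀ x, (∀ m ∈ K', 0 ≤ m ⬝ᵥ x) → ∀ k ∉ J, 0 ≤ a k ⬝ᵥ x := fun x hx k hk => by
    simpa [r, hk] using hcone' x hx k (hne k hk)
  have hconeJ : ∀ x, (∀ m ∈ K', 0 ≤ m ⬝ᵥ x) → ∀ k ∈ J, k ≠ j → a k ⬝ᵥ x ≤ 0 :=
    fun x hx k hk hkj => by simpa [r, hk] using hcone' x hx k hkj
  obtain ⟨V, hV, hVβ, hVD⟩ := D.exists_perturb
  -- rational right-hand sides converging to `β`
  have hq : ∀ (n : ℕ) k, ∃ q : ℚ, (k ∉ J → (q : ℝ) = β k) ∧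
      |(q : ℝ) - β k| ≤ 1 / ((n : ℝ) + 1) := by
    intro n k
    have hn : (0 : ℝ) < 1 / ((n : ℝ) + 1) := by positivity
    by_cases hk : k ∈ J
    · obtain ⟨q, h1, h2⟩ := exists_rat_btwn (lt_add_of_pos_right (β k) hn)
      exact ⟨q, fun h => absurd hk h, by rw [abs_le]; constructor <;> linarith⟩
    · obtain ⟨q, hq⟩ := (D.rat k).dotProduct D.rat_u
      rw [D.eq_u k hk] at hq
      exact ⟨q, fun _ => hq.symm, by simpa [hq] using hn.le⟩
  choose q hqJ hqβ using hq
  have hlim : Tendsto (fun n k => (q n k : ℝ)) (hyperfilter ℕ) (𝓝 β) := by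
    refine Tendsto.mono_left (tendsto_pi_nhds.2 fun k => ?_) Nat.hyperfilter_le_atTop
    rw [tendsto_iff_norm_sub_tendsto_zero]
    exact squeeze_zero (fun _ => norm_nonneg _) (fun n => hqβ n k)
      tendsto_one_div_add_atTop_nhds_zero_nat
  have hKpos : ∀ᶠ β' in 𝓝 β, ∀ m ∈ K', 0 < m ⬝ᵥ (V β' - u) :=
    (eventually_all_finset K').2 fun m hm =>
      (continuous_const.dotProduct (hV.sub continuous_const)).continuousAt.eventually
        (lt_mem_nhds (by simpa [hVβ] using hK'.pos m hm))
  refine hw (HasWalk.of_tendsto (D' := fun _ g _ => IsCircuitOf M g) hlim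
    (fun G g _ hG hg hg1 => IsCircuitOf.of_tendsto_self hM (haM ⟨j, rfl⟩) hG hg
      fun h0 => by simp [h0] at hg1) ?_)
  filter_upwards [hlim.eventually hVD, hlim.eventually hKpos] with n h1 h2
  have hqI : ∀ k ∉ J, (q n k : ℝ) = β k := hqJ n
  refine (h1 hqI).hasWalk_of_isFacetSystem h (fun k => ⟨q n k, rfl⟩)
    ⟨hK'.rat, h2, hK'.facet, hK'.ridge⟩ hc hKM haM hconeI fun x hx hxJ => hR x ?_ ?_ ?_
  · intro k hk
    have := hconeI _ hx k hk
    rw [dotProduct_sub, D.eq_u k hk] at this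
    linarith
  · intro k hk hkj
    have := hconeJ _ hx k hk hkj
    rw [dotProduct_sub] at this
    linarith
  · intro k hk
    have h3 := hxJ k hk
    have h4 := (abs_le.1 (hqβ n k)).1
    have h5 : 1 / ((n : ℝ) + 1) ≤ 1 := by
      rw [div_le_one (by positivity)]
      linarith [n.cast_nonneg (α := ℝ)]
    linarith

end IsDantzig

/-- Arbitrarily many real numbers are linearly independent over `ℚ` together with `1`. -/
theorem exists_linearIndependent_rat (f : ℕ) :
    ∃ x : Fin (f + 1) → ℝ, x 0 = 1 ∧ LinearIndependent ℚ x := by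
  have hrank : ((f + 1 : ℕ) : Cardinal) ≤ Module.rank ℚ ℝ := by
    rw [Real.rank_rat_real]
    exact (Cardinal.nat_lt_continuum _).le
  obtain ⟨s, hs, hli⟩ := le_rank_iff_exists_linearIndependent_finset.1 hrank
  let z : Fin (f + 1) → ℝ := fun i => (s.equivFinOfCardEq hs).symm i
  have hz : LinearIndependent ℚ z := hli.comp _ (s.equivFinOfCardEq hs).symm.injective
  have hz0 : z 0 ≠ 0 := hz.ne_zero 0
  refine ⟨fun i => (z 0)⁻¹ * z i, inv_mul_cancel₀ hz0,
    hz.map' (LinearMap.mulLeft ℚ (z 0)⁻¹) (LinearMap.ker_eq_bot.2 fun p q hpq => ?_)⟩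
  exact mul_left_cancel₀ (inv_ne_zero hz0) hpq

/-- Circuits of a rational family of vectors are multiples of rational vectors. -/
theorem IsCircuitOf.exists_isRatVec {d f : ℕ} {a : Fin f → Fin d → ℝ} (ha : ∀ k, IsRatVec (a k))
    {g : Fin d → ℝ} (hg : IsCircuitOf (Set.range a) g) :
    ∃ (c : ℝ) (z : Fin d → ℝ), IsRatVec z ∧ g = c • z := by
  choose q hq using ha
  let φ : (Fin d → ℚ) →ₗ[ℚ] ℝ :=
    { toFun := fun p => (fun i => (p i : ℝ)) ⬝ᵥ g
      map_add' := fun p p' => by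
        rw [← add_dotProduct]
        congr 1
        ext i
        simp
      map_smul' := fun c p => by
        simp [dotProduct, Finset.mul_sum, mul_assoc, Rat.smul_def] }
  by_cases hs : ∀ z : Fin d → ℚ, (∀ p ∈ {p | ∃ k, p = q k ∧ a k ⬝ᵥ g = 0}, p ⬝ᵥ z = 0) → z = 0
  · have h1 : ∀ p, φ p = 0 := by
      intro p
      have hp : p ∈ Submodule.span ℚ {p | ∃ k, p = q k ∧ a k ⬝ᵥ g = 0} :=
        span_eq_top_of_forall hs ▸ Submodule.mem_top
      have hle : Submodule.span ℚ {p | ∃ k, p = q k ∧ a k ⬝ᵥ g = 0} ≤ LinearMap.ker φ := by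
        refine Submodule.span_le.2 ?_
        rintro _ ⟨k, rfl, hk⟩
        change (fun i => (q k i : ℝ)) ⬝ᵥ g = 0
        rw [← hq, hk]
      exact hle hp
    refine ⟨0, 0, ⟨0, by ext; simp⟩, ?_⟩
    ext i
    have h2 : (fun j => ((Pi.single i 1 : Fin d → ℚ) j : ℝ)) ⬝ᵥ g = 0 := h1 (Pi.single i 1)
    have h3 : (fun j => ((Pi.single i 1 : Fin d → ℚ) j : ℝ)) = Pi.single i 1 := by
      ext j
      by_cases hj : j = i
      · subst hj; simp
      · simp [hj]
    rw [h3, single_dotProduct, one_mul] at h2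
    simp [h2]
  · push Not at hs
    obtain ⟨z, hz, hz0⟩ := hs
    obtain ⟨c, hc⟩ := hg (fun i => (z i : ℝ)) (by
      rintro _ ⟨k, rfl⟩ hk
      have := hz (q k) ⟨k, rfl, hk⟩
      rw [hq k]
      simp only [dotProduct] at this ⊢
      exact_mod_cast this)
    have hc0 : c ≠ 0 := by
      rintro rfl
      refine hz0 (funext fun i => ?_)
      have := congrFun hc i
      simpa using this
    exact ⟨c⁻¹, _, ⟨z, rfl⟩, by rw [hc, smul_smul, inv_mul_cancel₀ hc0, one_smul]⟩

/-- Rational multiples stay in a rational subspace of the real numbers. -/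
theorem Submodule.ratCast_mul_mem (L : Submodule ℚ ℝ) {x : ℝ} (hx : x ∈ L) (q : ℚ) :
    (q : ℝ) * x ∈ L := by
  rw [← Rat.smul_def]
  exact L.smul_mem q hx

theorem IsRatVec.dotProduct_mem {d : ℕ} {p y : Fin d → ℝ} (hp : IsRatVec p) {L : Submodule ℚ ℝ}
    (hy : ∀ i, y i ∈ L) : p ⬝ᵥ y ∈ L := by
  obtain ⟨q, rfl⟩ := hp
  exact L.sum_mem fun i _ => Submodule.ratCast_mul_mem L (hy i) _

/-- For generic right-hand sides, the target facet of a step is not parallel to that step. -/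
theorem HasWalk.of_linearIndependent {d f : ℕ} {a : Fin f → Fin d → ℝ} {J : Set (Fin f)}
    {u : Fin d → ℝ} {R : ℝ} {n : ℕ} {β : Fin f → ℝ} (ha : ∀ k, IsRatVec (a k)) (hu : IsRatVec u)
    {x : Fin (f + 1) → ℝ} (hx0 : x 0 = 1) (hx : LinearIndependent ℚ x)
    (hβ : ∀ k ∈ J, ∃ q c : ℚ, c ≠ 0 ∧ β k = q + c * x k.succ)
    (h : HasWalk a J u R n (fun g _ => IsCircuitOf (Set.range a) g) β) :
    HasWalk a J u R n (fun g k => IsCircuitOf (Set.range a) g ∧ a k ⬝ᵥ g ≠ 0) β := by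
  obtain ⟨m, hm, j, y, g, α, hy0, hym, hy, hstep, hj⟩ := h
  let U : ℕ → Set (Fin (f + 1)) := fun i =>
    insert 0 {k | ∃ i' : Fin m, (i' : ℕ) < i ∧ k = (j i').succ}
  let L : ℕ → Submodule ℚ ℝ := fun i => Submodule.span ℚ (x '' U i)
  have hmono : ∀ i, L i ≤ L (i + 1) := fun i => Submodule.span_mono (Set.image_mono
    (Set.insert_subset_insert fun k ⟨i', h1, h2⟩ => ⟨i', h1.trans i.lt_succ_self, h2⟩))
  have hrat : ∀ i (q : ℚ), (q : ℝ) ∈ L i := fun i q => by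
    have : (1 : ℝ) ∈ L i := Submodule.subset_span ⟨0, Set.mem_insert _ _, hx0⟩
    simpa using Submodule.ratCast_mul_mem _ this q
  have hne : ∀ i : Fin m, (∀ c, y i c ∈ L i) → a (j i) ⬝ᵥ g i ≠ 0 := by
    intro i hi h0
    obtain ⟨hjJ, -, -, -, hyi, hji⟩ := hstep i
    rw [hyi, dotProduct_add, dotProduct_smul, h0, smul_zero, add_zero] at hji
    obtain ⟨q, c, hc, hqc⟩ := hβ _ hjJ
    have h1 : x (j i).succ ∈ L i := by
      have h2 : (c : ℝ) * x (j i).succ ∈ L i := by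
        have : (c : ℝ) * x (j i).succ = a (j i) ⬝ᵥ y i - q := by rw [hji, hqc]; ring
        rw [this]
        exact (L i).sub_mem ((ha _).dotProduct_mem hi) (hrat _ _)
      have h3 := Submodule.ratCast_mul_mem _ h2 c⁻¹
      rwa [Rat.cast_inv, inv_mul_cancel_left₀ (Rat.cast_ne_zero.2 hc)] at h3
    refine hx.notMem_span_image ?_ h1
    rintro (h2 | ⟨i', hi', h2⟩)
    · exact Fin.succ_ne_zero _ h2
    · exact hi'.ne' (congrArg Fin.val (hj (Fin.succ_injective _ h2)))
  have hmem : ∀ i ≤ m, ∀ c, y i c ∈ L i := by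
    intro i
    induction i with
    | zero =>
      intro _ c
      obtain ⟨q, hq⟩ := hu
      rw [hy0, hq]
      exact hrat _ _
    | succ i ih =>
      intro hi c
      have hi' := ih (Nat.le_of_succ_le hi)
      have h0 := hne ⟨i, hi⟩ hi'
      obtain ⟨hjJ, -, hg, -, hyi, hji⟩ := hstep ⟨i, hi⟩
      obtain ⟨e, z, hz, hgz⟩ := hg.exists_isRatVec ha
      obtain ⟨r, hr⟩ := (ha (j ⟨i, hi⟩)).dotProduct hz
      have hr0 : (r : ℝ) ≠ 0 := by
        rintro h1
        rw [hgz, dotProduct_smul, hr, h1, smul_zero] at h0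
        exact h0 rfl
      obtain ⟨q, p, -, hqp⟩ := hβ _ hjJ
      have hβL : β (j ⟨i, hi⟩) ∈ L (i + 1) := by
        rw [hqp]
        refine (L _).add_mem (hrat _ _) (Submodule.ratCast_mul_mem _ ?_ _)
        exact Submodule.subset_span ⟨_, Or.inr ⟨⟨i, hi⟩, i.lt_succ_self, rfl⟩, rfl⟩
      have hαe : α ⟨i, hi⟩ * e ∈ L (i + 1) := by
        have h1 : (r : ℝ) * (α ⟨i, hi⟩ * e) = β (j ⟨i, hi⟩) - a (j ⟨i, hi⟩) ⬝ᵥ y i := by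
          rw [← hji, hyi, hgz, dotProduct_add, dotProduct_smul, dotProduct_smul, hr]
          simp only [smul_eq_mul]
          ring
        have h2 := Submodule.ratCast_mul_mem _ (h1 ▸ (L _).sub_mem hβL
          ((ha _).dotProduct_mem fun c => hmono i (hi' c))) r⁻¹
        rwa [Rat.cast_inv, inv_mul_cancel_left₀ hr0] at h2
      obtain ⟨z', rfl⟩ := hz
      have h3 : y (i + 1) c = y i c + z' c * (α ⟨i, hi⟩ * e) := by
        have := congrFun hyi c
        simp only [hgz, Pi.add_apply, Pi.smul_apply, smul_eq_mul] at this
        rw [this]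
        ring
      rw [h3]
      exact (L _).add_mem (hmono i (hi' c)) (Submodule.ratCast_mul_mem _ hαe _)
  exact ⟨m, hm, j, y, g, α, hy0, hym, hy, fun i => ⟨(hstep i).1, (hstep i).2.1,
    ⟨(hstep i).2.2.1, hne i (hmem i i.2.le)⟩, (hstep i).2.2.2⟩, hj⟩

/-- A rational Dantzig figure has a short walk of circuits leaving the interior of the target
facets. -/
theorem IsDantzig.exists_hasWalk {d f : ℕ} {a : Fin f → Fin d → ℝ} {J : Set (Fin f)}
    {u v : Fin d → ℝ} {b : Fin f → ℝ} (D : IsDantzig a J u v b) (hb : ∀ k, ∃ q : ℚ, b k = q)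
    (h : SpindleProperty d) (hd : 3 ≤ d) :
    ∃ R, HasWalk a J u R d (fun g k => IsCircuitOf (Set.range a) g ∧ a k ⬝ᵥ g ≠ 0) b := by
  classical
  obtain ⟨x, hx0, hx⟩ := exists_linearIndependent_rat f
  obtain ⟨j, hj, R, hR⟩ := D.exists_bound (by omega)
  obtain ⟨V, -, -, hV⟩ := D.exists_perturb
  let β : ℕ → Fin f → ℝ := fun n k => b k + if k ∈ J then 1 / ((n : ℝ) + 1) * x k.succ else 0
  have hβ : Tendsto β (hyperfilter ℕ) (𝓝 b) := by
    refine Tendsto.mono_left (tendsto_pi_nhds.2 fun k => ?_) Nat.hyperfilter_le_atTop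
    by_cases hk : k ∈ J
    · have := ((tendsto_one_div_add_atTop_nhds_zero_nat (𝕜 := ℝ)).mul_const (x k.succ)).const_add
        (b k)
      simpa [β, hk] using this
    · simp [β, hk]
  have hβJ : ∀ n, ∀ k ∉ J, β n k = b k := fun n k hk => by simp [β, hk]
  have hclose : ∀ᶠ β' in 𝓝 b, ∀ k, b k - 1 < β' k := eventually_all.2 fun k =>
    (continuous_apply k).continuousAt.eventually (lt_mem_nhds (sub_one_lt _))
  refine ⟨R, HasWalk.of_tendsto (D' := fun _ g k => IsCircuitOf (Set.range a) g ∧ a k ⬝ᵥ g ≠ 0) hβ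
    (fun G g k hG hg hg1 => ?_) ?_⟩
  · have hg0 : g ≠ 0 := fun h0 => by simp [h0] at hg1
    have hG1 := hG.mono fun t ht => ht.1
    exact ⟨IsCircuitOf.of_tendsto_self (Set.finite_range a) ⟨k, rfl⟩ hG1 hg hg0,
      IsCircuitOf.dotProduct_ne_zero_of_tendsto (Set.finite_range a) hG1 hg hg0
        (hG.mono fun t ht => ht.2)⟩
  · filter_upwards [hβ.eventually hV, hβ.eventually hclose] with n h1 h2
    refine HasWalk.of_linearIndependent D.rat D.rat_u hx0 hx (fun k hk => ?_)
      ((h1 (hβJ n)).hasWalk h hd hj fun y hy1 hy2 hy3 => hR y (fun k hk => ?_) hy2 fun k hk => ?_)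
    · obtain ⟨q, hq⟩ := hb k
      exact ⟨q, 1 / ((n : ℚ) + 1), by positivity, by simp [β, hk, hq]⟩
    · rw [← hβJ n k hk]
      exact hy1 k hk
    · have := hy3 k hk
      have := h2 k
      linarith

namespace PolyData

variable {d f : ℕ} {P : PolyData d f} {u v y z g : Fin d → ℝ}

/-- A maximal step along a circuit from `y` to `z`. -/
def IsCircuitStep (P : PolyData d f) (y z : Fin d → ℝ) : Prop :=
  ∃ g ∈ P.circuits, ∃ α : ℝ, 0 < α ∧ z = y + α • g ∧ ∀ β : ℝ, α < β → y + β • g ∉ P.toSet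

theorem IsCircuitWalk.snoc {k : ℕ} {y : Fin (k + 1) → Fin d → ℝ} (hy : P.IsCircuitWalk y)
    (hz : z ∈ P.toSet) (h : P.IsCircuitStep (y (Fin.last k)) z) :
    P.IsCircuitWalk (Fin.snoc y z : Fin (k + 1 + 1) → Fin d → ℝ) := by
  refine ⟨fun i => ?_, fun i => ?_⟩
  · induction i using Fin.lastCases with
    | last => simpa using hz
    | cast i => simpa using hy.1 i
  · induction i using Fin.lastCases with
    | last =>
      simp only [Fin.succ_last, Fin.snoc_last, Fin.snoc_castSucc]
      exact h
    | cast i =>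
      rw [Fin.succ_castSucc]
      simpa only [Fin.snoc_castSucc] using hy.2 i

/-- Deleting trivial steps gives a circuit walk. -/
theorem circuitDistance_le_of_forall_step {m n : ℕ} (hmn : m ≤ n) {y : ℕ → Fin d → ℝ}
    (hy : ∀ i ≤ m, y i ∈ P.toSet)
    (hstep : ∀ i < m, y (i + 1) = y i ∨ P.IsCircuitStep (y i) (y (i + 1))) :
    P.circuitDistance (y 0) (y m) ≤ n := by
  have key : ∀ i ≤ m, ∃ k ≤ i, ∃ z : Fin (k + 1) → Fin d → ℝ,
      P.IsCircuitWalk z ∧ z 0 = y 0 ∧ z (Fin.last k) = y i := by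
    intro i
    induction i with
    | zero =>
      exact fun _ => ⟨0, le_rfl, fun _ => y 0, ⟨fun _ => hy 0 (Nat.zero_le _), fun i => i.elim0⟩,
        rfl, rfl⟩
    | succ i ih =>
      intro hi
      obtain ⟨k, hk, z, hz, hz0, hzi⟩ := ih (Nat.le_of_succ_le hi)
      rcases hstep i hi with h | h
      · exact ⟨k, hk.trans i.le_succ, z, hz, hz0, hzi.trans h.symm⟩
      · refine ⟨k + 1, Nat.succ_le_succ hk, Fin.snoc z (y (i + 1)),
          hz.snoc (hy _ hi) (hzi ▸ h), ?_, Fin.snoc_last _ _⟩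
        rw [← Fin.castSucc_zero, Fin.snoc_castSucc, hz0]
  obtain ⟨k, hk, z, hz⟩ := key m le_rfl
  have hle : P.circuitDistance (y 0) (y m) ≤ (k : ℕ∞) := sInf_le ⟨k, rfl, z, hz⟩
  exact hle.trans (by exact_mod_cast hk.trans hmn)

/-- A circuit step is maximal if it ends on a facet not parallel to it. -/
theorem isCircuitStep_of_isCircuitOf (hy : y ∈ P.toSet) (hg : IsCircuitOf (Set.range P.row) g)
    {j : Fin f} (hj : P.row j ⬝ᵥ g ≠ 0) {α : ℝ} (hα : 0 < α)
    (hz : P.row j ⬝ᵥ (y + α • g) = P.rhs j) : P.IsCircuitStep y (y + α • g) := by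
  have hg0 : g ≠ 0 := by rintro rfl; simp at hj
  refine ⟨g, P.isCircuit_of_isCircuitOf hg0 hg, α, hα, rfl, fun β hβ hmem => ?_⟩
  have h1 : P.rhs j ≤ P.row j ⬝ᵥ y := hy j
  have h2 : P.rhs j ≤ P.row j ⬝ᵥ (y + β • g) := hmem j
  rw [dotProduct_add, dotProduct_smul, smul_eq_mul] at hz h2
  have h3 : P.row j ⬝ᵥ g < 0 := lt_of_le_of_ne (nonpos_of_mul_nonpos_right (by linarith) hα) hj
  nlinarith

theorem circuitDistance_le_of_hasWalk {R : ℝ} {n : ℕ} {J : Set (Fin f)}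
    (hv : ∀ k ∈ J, P.row k ⬝ᵥ v = P.rhs k)
    (hJ : ∀ x, (∀ k ∈ J, P.row k ⬝ᵥ x = 0) → x = 0)
    (h : HasWalk P.row J u R n
      (fun g k => IsCircuitOf (Set.range P.row) g ∧ P.row k ⬝ᵥ g ≠ 0) P.rhs) :
    P.circuitDistance u v ≤ n := by
  obtain ⟨m, hm, j, y, g, α, hy0, hym, hy, hstep, -⟩ := h
  have hymv : y m = v := sub_eq_zero.1 (hJ _ fun k hk => by
    rw [dotProduct_sub, hym k hk, hv k hk, sub_self])
  have hmem : ∀ i ≤ m, y i ∈ P.toSet := fun i hi => (hy i hi).2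
  rw [← hy0, ← hymv]
  refine circuitDistance_le_of_forall_step hm hmem fun i hi => ?_
  obtain ⟨-, -, ⟨hg, hj⟩, hα, hyi, hji⟩ := hstep ⟨i, hi⟩
  rcases hα.eq_or_lt with h0 | h0
  · left
    simpa [← h0] using hyi
  · right
    change y (i + 1) = _ at hyi
    change P.row _ ⬝ᵥ y (i + 1) = _ at hji
    rw [hyi] at hji ⊢
    exact isCircuitStep_of_isCircuitOf (hmem i hi.le) hg hj h0 hji

theorem IsDantzigFigure.isDantzig {P : PolyData d (2 * d)} (h : P.IsDantzigFigure u v) :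
    IsDantzig P.row (P.activeAt v) u v P.rhs := by
  obtain ⟨⟨hu, hu'⟩, ⟨hv, hv'⟩, hdisj, hunion, hcu, hcv⟩ := h
  have hcompl : (P.activeAt v)ᶜ = P.activeAt u :=
    (IsCompl.symm ⟨hdisj, codisjoint_iff.2 hunion⟩).compl_eq
  have hact : ∀ k, k ∉ P.activeAt v ↔ k ∈ P.activeAt u := fun k => by
    rw [← hcompl, Set.mem_compl_iff]
  have hzero : ∀ z, Submodule.span ℝ (P.row '' P.activeAt z) = ⊤ →
      ∀ x, (∀ k ∈ P.activeAt z, P.row k ⬝ᵥ x = 0) → x = 0 := fun z hz x hx =>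
    eq_zero_of_span_eq_top hz (by rintro _ ⟨k, hk, rfl⟩; exact hx k hk)
  refine
    { rat := fun k => ⟨P.A k, rfl⟩
      rat_u := ?_
      eq_u := fun k hk => (hact k).1 hk
      lt_u := fun k hk => lt_of_le_of_ne (hu k) fun h0 =>
        Set.disjoint_left.1 hdisj (show k ∈ P.activeAt u from h0.symm) hk
      eq_v := fun k hk => hk
      lt_v := fun k hk => lt_of_le_of_ne (hv k) fun h0 => hk h0.symm
      eq_zero_u := fun x hx => hzero u hu' x fun k hk => hx k ((hact k).2 hk)
      eq_zero_v := hzero v hv'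
      ncard := hcv
      ncard_compl := hcompl ▸ hcu }
  have hcast : ∀ k (x : Fin d → ℚ), P.row k ⬝ᵥ (fun i => (x i : ℝ)) = ((P.A k ⬝ᵥ x : ℚ) : ℝ) :=
    fun k x => by simp [dotProduct, row]
  obtain ⟨w, hw, -⟩ := exists_dual_basis P.A hcu fun x hx => by
    have h0 := hzero u hu' (fun i => (x i : ℝ)) fun k hk => by rw [hcast, hx k hk, Rat.cast_zero]
    ext i
    simpa using congrFun h0 i
  refine ⟨∑ k, P.b k • w k, sub_eq_zero.1 (hzero u hu' _ fun k hk => ?_)⟩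
  have h1 : P.row k ⬝ᵥ u = P.rhs k := hk
  rw [dotProduct_sub, hcast, h1]
  simp [dotProduct_sum, dotProduct_smul, hw k hk, rhs]

theorem isCircuitOf_of_dotProduct_eq_zero {M : Set (Fin 2 → ℝ)} {p g : Fin 2 → ℝ} (hp : p ∈ M)
    (hp0 : p ≠ 0) (hg0 : g ≠ 0) (h : p ⬝ᵥ g = 0) : IsCircuitOf M g := by
  intro x hx
  have hpx := hx p hp h
  simp only [dotProduct, Fin.sum_univ_two] at h hpx
  have hdet : x 0 * g 1 = x 1 * g 0 := by
    by_cases h0 : p 0 = 0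
    · have h1 : p 1 ≠ 0 := fun h1 => hp0 (by ext i; fin_cases i <;> simp [h0, h1])
      simp only [h0, zero_mul, zero_add, mul_eq_zero, h1, false_or] at h hpx
      simp [h, hpx]
    · refine mul_left_cancel₀ h0 ?_
      linear_combination g 1 * hpx - x 1 * h
  by_cases h0 : g 0 = 0
  · have h1 : g 1 ≠ 0 := fun h1 => hg0 (by ext i; fin_cases i <;> simp [h0, h1])
    refine ⟨x 1 / g 1, ?_⟩
    ext i
    fin_cases i
    · have : x 0 = 0 := by simpa [h0, h1] using hdet
      simp [this, h0]
    · simp [h1]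
  · refine ⟨x 0 / g 0, ?_⟩
    ext i
    fin_cases i
    · simp [h0]
    · have : x 1 = x 0 / g 0 * g 1 := by field_simp; linarith
      simpa using this

theorem IsDantzigFigure.circuitDistance_le_one {P : PolyData 1 (2 * 1)} {u v : Fin 1 → ℝ}
    (h : P.IsDantzigFigure u v) : P.circuitDistance u v ≤ (1 : ℕ) := by
  have D := h.isDantzig
  obtain ⟨j, hj⟩ : (P.activeAt v).Nonempty :=
    Set.nonempty_of_ncard_ne_zero (by rw [D.ncard]; exact one_ne_zero)
  have hjg : P.row j ⬝ᵥ (v - u) ≠ 0 := by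
    rw [dotProduct_sub, D.eq_v j hj, sub_ne_zero]
    exact (D.lt_u j hj).ne
  have hg0 : (v - u) 0 ≠ 0 := fun h0 => hjg (by
    rw [dotProduct, Fin.sum_univ_one, h0, mul_zero])
  have hcirc : IsCircuitOf (Set.range P.row) (v - u) := fun x _ =>
    ⟨x 0 / (v - u) 0, by
      ext i
      rw [Subsingleton.elim i 0, Pi.smul_apply, smul_eq_mul, div_mul_cancel₀ _ hg0]⟩
  have hv : v = u + (1 : ℝ) • (v - u) := by simp
  have hstep := isCircuitStep_of_isCircuitOf h.1.1 hcirc hjg one_pos (by rw [← hv, D.eq_v j hj])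
  rw [← hv] at hstep
  refine circuitDistance_le_of_forall_step le_rfl (y := fun n => if n = 0 then u else v) ?_ ?_
  · intro i _
    split_ifs
    exacts [h.1.1, h.2.1.1]
  · intro i hi
    obtain rfl : i = 0 := by omega
    exact Or.inr hstep

theorem IsDantzigFigure.circuitDistance_le_two {P : PolyData 2 (2 * 2)} {u v : Fin 2 → ℝ}
    (h : P.IsDantzigFigure u v) : P.circuitDistance u v ≤ (2 : ℕ) := by
  have D := h.isDantzig
  set J := P.activeAt v
  obtain ⟨w, hw, hw0⟩ := exists_dual_basis P.row D.ncard_compl D.eq_zero_u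
  obtain ⟨j, hj⟩ : J.Nonempty := Set.nonempty_of_ncard_ne_zero (by rw [D.ncard]; exact two_ne_zero)
  obtain ⟨i, hi, hij⟩ : ∃ i ∉ J, P.row j ⬝ᵥ w i < 0 := by
    by_contra! hcon
    have h1 : v - u = ∑ k, (P.row k ⬝ᵥ (v - u)) • w k :=
      eq_sum_dual_basis D.eq_zero_u hw fun _ _ => rfl
    have h2 : 0 ≤ P.row j ⬝ᵥ (v - u) := by
      rw [h1, dotProduct_sum]
      refine Finset.sum_nonneg fun k _ => ?_
      by_cases hk : k ∈ J
      · simp [hw0 k (by simpa using hk)]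
      · have := D.eq_u k hk
        have := D.lt_v k hk
        rw [dotProduct_smul, dotProduct_sub]
        exact mul_nonneg (by linarith) (hcon k hk)
    have := D.lt_u j hj
    have := D.eq_v j hj
    rw [dotProduct_sub] at h2
    linarith
  obtain ⟨i', hi', hii'⟩ := Set.exists_ne_of_one_lt_ncard (s := Jᶜ)
    (by rw [D.ncard_compl]; exact one_lt_two) i
  -- the first facet in `J` hit by the ray from `u` in direction `w i`
  obtain ⟨k, ⟨hkJ, hk⟩, hmin⟩ := Set.exists_min_image {k | k ∈ J ∧ P.row k ⬝ᵥ w i < 0}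
    (fun k => (P.row k ⬝ᵥ u - P.rhs k) / (-(P.row k ⬝ᵥ w i))) (Set.toFinite _) ⟨j, hj, hij⟩
  set t := (P.row k ⬝ᵥ u - P.rhs k) / (-(P.row k ⬝ᵥ w i)) with ht
  have ht0 : 0 < t := div_pos (sub_pos.2 (D.lt_u k hkJ)) (neg_pos.2 hk)
  have htk : P.row k ⬝ᵥ (u + t • w i) = P.rhs k := by
    rw [dotProduct_add, dotProduct_smul, smul_eq_mul, ht, div_neg, neg_mul,
      div_mul_cancel₀ _ hk.ne]
    ring
  have hmem : u + t • w i ∈ P.toSet := by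
    intro k'
    change P.rhs k' ≤ P.row k' ⬝ᵥ (u + t • w i)
    rw [dotProduct_add, dotProduct_smul, smul_eq_mul]
    by_cases hk' : k' ∈ J
    · by_cases hneg : P.row k' ⬝ᵥ w i < 0
      · have := hmin k' ⟨hk', hneg⟩
        rw [le_div_iff₀ (neg_pos.2 hneg)] at this
        linarith
      · have := D.lt_u k' hk'
        have := mul_nonneg ht0.le (not_lt.1 hneg)
        linarith
    · rw [D.eq_u k' hk', hw k' hk' i]
      split_ifs <;> linarith
  have hwi : w i ≠ 0 := fun h0 => by simp [h0] at hij
  have hstep₁ : P.IsCircuitStep u (u + t • w i) := by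
    refine isCircuitStep_of_isCircuitOf h.1.1
      (isCircuitOf_of_dotProduct_eq_zero ⟨i', rfl⟩ ?_ hwi ?_) hk.ne ht0 htk
    · intro h0
      have := hw i' hi' i'
      simp [h0] at this
    · rw [hw i' hi' i, if_neg hii']
  have hstep₂ : v = u + t • w i ∨ P.IsCircuitStep (u + t • w i) v := by
    by_cases hne : v = u + t • w i
    · exact Or.inl hne
    have hg0 : v - (u + t • w i) ≠ 0 := sub_ne_zero.2 hne
    obtain ⟨k', hk'J, hk'⟩ : ∃ k' ∈ J, P.row k' ⬝ᵥ (v - (u + t • w i)) ≠ 0 := by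
      by_contra! hcon
      exact hg0 (D.eq_zero_v _ hcon)
    have hv : v = u + t • w i + (1 : ℝ) • (v - (u + t • w i)) := by simp
    have hstep := isCircuitStep_of_isCircuitOf hmem (isCircuitOf_of_dotProduct_eq_zero
      (M := Set.range P.row) ⟨k, rfl⟩ (fun h0 => by simp [h0] at hk) hg0 (by
        rw [dotProduct_sub, htk, D.eq_v k hkJ, sub_self])) hk' one_pos
      (by rw [← hv, D.eq_v k' hk'J])
    rw [← hv] at hstep
    exact Or.inr hstep
  refine circuitDistance_le_of_forall_step le_rfl
    (y := fun n => if n = 0 then u else if n = 1 then u + t • w i else v) ?_ ?_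
  · intro n _
    split_ifs
    exacts [h.1.1, hmem, h.2.1.1]
  · intro n hn
    obtain rfl | rfl : n = 0 ∨ n = 1 := by omega
    · exact Or.inr hstep₁
    · exact hstep₂

end PolyData

end

/-- Corollary 14: if every `d`-dimensional bounded spindle
with `2d-1` facets incident to `u` and `d` facets incident to `v` admits a
non-revisiting circuit walk from `u` to `v` of length at most `d`, then every
`d`-dimensional Dantzig figure (bounded or unbounded) has circuit distance at
most `d` between its two distinguished vertices. -/
theorem dstep_from_spindles (d : ℕ)
    (h : ∀ (P : PolyData d (3*d - 1)) (u v : Fin d → ℝ), P.IsProper →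
      Bornology.IsBounded P.toSet → P.IsVertex u → P.IsVertex v →
      Disjoint (P.activeAt u) (P.activeAt v) →
      P.activeAt u ∪ P.activeAt v = Set.univ →
      (P.activeAt u).ncard = 2*d - 1 → (P.activeAt v).ncard = d →
        ∃ (m : ℕ) (y : Fin (m+1) → Fin d → ℝ), m ≤ d ∧ P.IsCircuitWalk y ∧
          P.IsNonRevisiting y ∧ y 0 = u ∧ y (Fin.last m) = v) :
    ∀ (P : PolyData d (2*d)) (u v : Fin d → ℝ), P.IsProper →
      P.IsDantzigFigure u v → P.circuitDistance u v ≤ (d : ℕ∞) := by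
  intro P u v _ hP
  rcases Nat.lt_or_ge d 3 with hd | hd
  · interval_cases d
    · obtain rfl : u = v := Subsingleton.elim _ _
      exact PolyData.circuitDistance_le_of_forall_step (m := 0) le_rfl (y := fun _ => u)
        (fun _ _ => hP.1.1) fun i hi => absurd hi (Nat.not_lt_zero i)
    · exact hP.circuitDistance_le_one
    · exact hP.circuitDistance_le_two
  · have D := hP.isDantzig
    obtain ⟨R, hR⟩ := D.exists_hasWalk (fun k => ⟨P.b k, rfl⟩) h hd
    exact PolyData.circuitDistance_le_of_hasWalk D.eq_v D.eq_zero_v hR
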